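/- arXiv:2405.18173 — 2 statements merged into one kernel-verified Lean document; each statement's English description precedes it below -/
import Mathlib

section
/- Let G=(V,E,ω,μ) be an infinite, locally finite, connected weighted graph with D_μ<∞, let p>1, and let ψ:V→[0,∞) be bounded with ψ≢0. Suppose there are a vertex x̃∈V and a constant ψ_∞>0 such that lim_{d(x̃,x)→∞} ψ(x) = ψ_∞, G satisfies the eigenvalue condition (EC), and in addition ψ(x) ≤ ψ_∞ for all x∈V. Then lim_{λ→0} λ^{p-1} T_λ = 1/((p-1) ψ_∞^{p-1}). -/
open Filter Topology Set
open scoped ENNReal Classical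

noncomputable section

/-- The graph Laplacian `Δu(x) = (1/μ(x)) ∑_y ω(x,y) (u(y) − u(x))`. -/
def graphLap {V : Type*} (ω : V → V → ℝ) (μ : V → ℝ) (u : V → ℝ) (x : V) : ℝ :=
  (1 / μ x) * ∑' y, ω x y * (u y - u x)

/-- `(V, ω, μ)` is a locally finite connected weighted graph: `ω` is symmetric and
nonnegative (with `ω x y > 0` exactly for neighbours), there are no loops, every
vertex has finitely many neighbours, `μ > 0`, and the graph is connected. -/
structure IsWeightedGraph {V : Type*} (ω : V → V → ℝ) (μ : V → ℝ) : Prop where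
  symm : ∀ x y, ω x y = ω y x
  nonneg : ∀ x y, 0 ≤ ω x y
  loopless : ∀ x, ω x x = 0
  locallyFinite : ∀ x, {y | 0 < ω x y}.Finite
  measurePos : ∀ x, 0 < μ x
  connected : ∀ x y, Relation.ReflTransGen (fun a b => 0 < ω a b) x y

/-- `D_μ = sup_x m(x)/μ(x) < ∞`, where `m(x) = ∑_{y ∼ x} ω(x,y)`. -/
def DmuFinite {V : Type*} (ω : V → V → ℝ) (μ : V → ℝ) : Prop :=
  ∃ C : ℝ, ∀ x, (∑' y, ω x y) ≤ C * μ x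

/-- A solution of `u_t = L u + u^p` on `V × [0,T)` with initial datum `ψ0`:
a nonnegative function, continuous in `t` on `[0,T)` for each fixed `x`,
bounded on `V × [0,T']` for every `T' < T`, differentiable in `t` on `(0,T)`
and satisfying the equation pointwise there. -/
structure IsHeatSol {V : Type*} (L : (V → ℝ) → V → ℝ) (p : ℝ)
    (ψ0 : V → ℝ) (T : ℝ) (u : V → ℝ → ℝ) : Prop where
  nonneg : ∀ x, ∀ t ∈ Ico (0:ℝ) T, 0 ≤ u x t
  cont : ∀ x, ContinuousOn (u x) (Ico (0:ℝ) T)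
  bounded : ∀ T' ∈ Ioo (0:ℝ) T, ∃ C : ℝ, ∀ x, ∀ t ∈ Icc (0:ℝ) T', |u x t| ≤ C
  eqn : ∀ x, ∀ t ∈ Ioo (0:ℝ) T,
    HasDerivAt (u x) (L (fun y => u y t) x + u x t ^ p) t
  init : ∀ x, u x 0 = ψ0 x

/-- The life span `T_λ`: the supremum (in `ℝ≥0∞`) of all `T > 0` such that the
problem has a solution on `[0,T)`. -/
def lifeSpan {V : Type*} (L : (V → ℝ) → V → ℝ) (p : ℝ) (ψ0 : V → ℝ) : ℝ≥0∞ :=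
  ⨆ (T : ℝ) (_ : 0 < T ∧ ∃ u, IsHeatSol L p ψ0 T u), ENNReal.ofReal T

/-- There is a path with `n` edges from `x` to `y`. -/
def ReachesIn {V : Type*} (ω : V → V → ℝ) (n : ℕ) (x y : V) : Prop :=
  ∃ f : ℕ → V, f 0 = x ∧ f n = y ∧ ∀ i < n, 0 < ω (f i) (f (i + 1))

/-- The graph distance: the least number of edges of a path joining `x` and `y`. -/
def graphDist {V : Type*} (ω : V → V → ℝ) (x y : V) : ℕ :=
  sInf {n : ℕ | ReachesIn ω n x y}

/-- The interior `Ω° = Ω ∖ ∂Ω` of a finite vertex set `Ω`. -/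
def finInterior {V : Type*} (ω : V → V → ℝ) (Ω : Finset V) : Set V :=
  {x | x ∈ Ω ∧ ∀ y, 0 < ω x y → y ∈ Ω}

/-- `Ω` is connected as a subgraph. -/
def FinsetConnected {V : Type*} (ω : V → V → ℝ) (Ω : Finset V) : Prop :=
  ∀ x ∈ Ω, ∀ y ∈ Ω, Relation.ReflTransGen (fun a b => a ∈ Ω ∧ b ∈ Ω ∧ 0 < ω a b) x y

/-- The smallest eigenvalue `λ₁(Ω)` of the Dirichlet eigenvalue problem
`-Δ_Ω φ = λ φ` on `Ω°`, `φ = 0` on `∂Ω` (eigenfunctions are extended by zero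
outside `Ω°`, so that `Δ_Ω` agrees with the graph Laplacian on `Ω°`). -/
def lambdaOne {V : Type*} (ω : V → V → ℝ) (μ : V → ℝ) (Ω : Finset V) : ℝ :=
  sInf {l : ℝ | ∃ φ : V → ℝ, φ ≠ 0 ∧ (∀ x, x ∉ finInterior ω Ω → φ x = 0) ∧
    ∀ x ∈ finInterior ω Ω, -graphLap ω μ φ x = l * φ x}

/-- The eigenvalue condition (EC) relative to the vertex `xt`: for all `ε, δ > 0`
there is a finite connected subset `Ω ⊆ V` with nonempty interior such that
`λ₁(Ω) < ε` and `d(x, xt) > δ` for all `x ∈ Ω`. -/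
def EigenCond {V : Type*} (ω : V → V → ℝ) (μ : V → ℝ) (xt : V) : Prop :=
  ∀ ε > (0:ℝ), ∀ δ : ℝ, 0 < δ → ∃ Ω : Finset V, FinsetConnected ω Ω ∧
    (finInterior ω Ω).Nonempty ∧ lambdaOne ω μ Ω < ε ∧
    ∀ x ∈ Ω, δ < (graphDist ω xt x : ℝ)

theorem graphLap_eq_sum {V : Type*} {ω : V → V → ℝ} (hω : ∀ x y, 0 ≤ ω x y) (μ u : V → ℝ)
    (x : V) (s : Finset V) (hs : ∀ y, 0 < ω x y → y ∈ s) :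
    graphLap ω μ u x = 1 / μ x * ∑ y ∈ s, ω x y * (u y - u x) := by
  unfold graphLap
  rw [tsum_eq_sum (s := s)]
  intro y hy
  have : ω x y = 0 := le_antisymm (not_lt.1 fun h => hy (hs y h)) (hω x y)
  simp [this]

/-- The Dirichlet eigenvalue problem on a finite set with nonempty interior has an eigenvalue. -/
theorem exists_dirichlet_eigenfunction {V : Type*} {ω : V → V → ℝ} {μ : V → ℝ}
    (hG : IsWeightedGraph ω μ) (Ω : Finset V) (hne : (finInterior ω Ω).Nonempty) :
    ∃ (l : ℝ) (φ : V → ℝ), φ ≠ 0 ∧ (∀ x, x ∉ finInterior ω Ω → φ x = 0) ∧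
      ∀ x ∈ finInterior ω Ω, -graphLap ω μ φ x = l * φ x := by
  have hsub : finInterior ω Ω ⊆ (Ω : Set V) := fun x hx => hx.1
  have hfin : (finInterior ω Ω).Finite := Ω.finite_toSet.subset hsub
  have : Fintype (finInterior ω Ω) := hfin.fintype
  let A : Matrix (finInterior ω Ω) (finInterior ω Ω) ℝ := fun i j =>
    (if i = j then (∑ y ∈ Ω, ω i y) / μ i else 0) - ω i j / (√(μ i) * √(μ j))
  have hA : A.IsHermitian := by
    ext i j
    rw [Matrix.conjTranspose_apply, star_trivial]
    simp only [A, hG.symm j i, mul_comm √(μ j)]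
    by_cases h : i = j
    · subst h; rfl
    · simp [h, Ne.symm h]
  obtain ⟨x₀, hx₀⟩ := hne
  let i₀ : finInterior ω Ω := ⟨x₀, hx₀⟩
  let v : finInterior ω Ω → ℝ := (hA.eigenvectorBasis i₀).ofLp
  have hv : A.mulVec v = hA.eigenvalues i₀ • v := hA.mulVec_eigenvectorBasis i₀
  have hv0 : v ≠ 0 := by
    intro h
    apply hA.eigenvectorBasis.toBasis.ne_zero i₀
    rw [OrthonormalBasis.coe_toBasis]
    ext i
    exact congrFun h i
  have hsq : ∀ x, 0 < √(μ x) := fun x => Real.sqrt_pos.2 (hG.measurePos x)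
  let φ : V → ℝ := fun x => if h : x ∈ finInterior ω Ω then v ⟨x, h⟩ / √(μ x) else 0
  have hφin : ∀ i : finInterior ω Ω, φ i = v i / √(μ i) := fun i => by simp [φ, i.2]
  have hφout : ∀ x, x ∉ finInterior ω Ω → φ x = 0 := fun x hx => by simp [φ, hx]
  refine ⟨hA.eigenvalues i₀, φ, ?_, hφout, ?_⟩
  · intro h
    apply hv0
    funext i
    have := hφin i
    rw [h] at this
    simpa [(hsq i).ne'] using this.symm
  · intro x hx
    rw [graphLap_eq_sum hG.nonneg μ φ x Ω hx.2]
    have hsum : ∑ y ∈ Ω, ω x y * φ y = ∑ j : finInterior ω Ω, ω x j * (v j / √(μ j)) := by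
      have h1 : ∑ y ∈ hfin.toFinset, ω x y * φ y = ∑ y ∈ Ω, ω x y * φ y := by
        apply Finset.sum_subset
        · intro y hy; exact hsub (hfin.mem_toFinset.1 hy)
        · intro y _ hy
          rw [hφout y (fun h => hy (hfin.mem_toFinset.2 h)), mul_zero]
      rw [← h1, Finset.sum_subtype hfin.toFinset (p := (· ∈ finInterior ω Ω))
        (fun y => hfin.mem_toFinset)]
      exact Finset.sum_congr rfl fun j _ => by rw [hφin]
    have hev := congrFun hv ⟨x, hx⟩
    simp only [Matrix.mulVec, dotProduct, A, sub_mul, Finset.sum_sub_distrib, ite_mul, zero_mul,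
      Finset.sum_ite_eq, Finset.mem_univ, if_true, Pi.smul_apply, smul_eq_mul] at hev
    have hx' : φ x = v ⟨x, hx⟩ / √(μ x) := hφin ⟨x, hx⟩
    have h2 : ∑ j : finInterior ω Ω, ω x j / (√(μ x) * √(μ j)) * v j
        = (1 / √(μ x)) * ∑ j : finInterior ω Ω, ω x j * (v j / √(μ j)) := by
      rw [Finset.mul_sum]
      refine Finset.sum_congr rfl fun j _ => ?_
      have := (hsq x).ne'
      have := (hsq j).ne'
      field_simp
    rw [h2, ← hsum] at hev
    simp only [mul_sub, Finset.sum_sub_distrib, ← Finset.sum_mul]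
    have h3 : √(μ x) * √(μ x) = μ x := Real.mul_self_sqrt (hG.measurePos x).le
    have hs := (hsq x).ne'
    have hm := (hG.measurePos x).ne'
    have h4 : v ⟨x, hx⟩ = √(μ x) * φ x := by rw [hx']; field_simp
    rw [h4] at hev
    have h5 : 1 / μ x = 1 / √(μ x) * (1 / √(μ x)) := by
      rw [one_div_mul_one_div, h3]
    rw [div_eq_mul_one_div _ (μ x)] at hev
    apply mul_left_cancel₀ hs
    have h6 : √(μ x) * (1 / μ x) = 1 / √(μ x) := by rw [h5]; field_simp
    calc √(μ x) * -(1 / μ x * ∑ y ∈ Ω, ω x y * φ y - 1 / μ x * ((∑ y ∈ Ω, ω x y) * φ x))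
        = (∑ y ∈ Ω, ω x y) * (1 / μ x) * (√(μ x) * φ x)
          - √(μ x) * (1 / μ x) * ∑ y ∈ Ω, ω x y * φ y := by ring
      _ = √(μ x) * (hA.eigenvalues i₀ * φ x) := by rw [h6, hev]; ring

/-- A subsolution of the Dirichlet eigenvalue problem gives a finitely supported probability
weight under which the Laplacian of nonnegative functions is bounded below. -/
theorem exists_weight {V : Type*} {ω : V → V → ℝ} {μ : V → ℝ}
    (hG : IsWeightedGraph ω μ) (Ω : Finset V) (hne : (finInterior ω Ω).Nonempty) (ε : ℝ)
    (hε : lambdaOne ω μ Ω < ε) :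
    ∃ w : V → ℝ, (∀ x, 0 ≤ w x) ∧ ∑ x ∈ Ω, w x = 1 ∧
      ∀ u : V → ℝ, (∀ x, 0 ≤ u x) →
        -ε * ∑ x ∈ Ω, w x * u x ≤ ∑ x ∈ Ω, w x * graphLap ω μ u x := by
  obtain ⟨l, ⟨φ, hφ0, hφout, hφ⟩, hl⟩ :=
    exists_lt_of_csInf_lt (exists_dirichlet_eigenfunction hG Ω hne) hε
  have hμ := hG.measurePos
  have hkato : ∀ x ∈ Ω, -ε * (μ x * |φ x|) ≤ ∑ y ∈ Ω, ω x y * (|φ y| - |φ x|) := by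
    intro x _
    have hzero : φ x = 0 → -ε * (μ x * |φ x|) ≤ ∑ y ∈ Ω, ω x y * (|φ y| - |φ x|) := by
      intro h
      simp only [h, abs_zero, mul_zero, sub_zero]
      exact Finset.sum_nonneg fun y _ => mul_nonneg (hG.nonneg x y) (abs_nonneg _)
    by_cases hx : x ∈ finInterior ω Ω
    · have h1 := hφ x hx
      rw [graphLap_eq_sum hG.nonneg μ φ x Ω hx.2] at h1
      have h2 : ∑ y ∈ Ω, ω x y * (φ y - φ x) = -(l * (μ x * φ x)) := by
        have := (hμ x).ne'
        field_simp at h1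
        linarith
      have h3 : -ε * (μ x * |φ x|) ≤ -(l * (μ x * |φ x|)) := by
        have := mul_nonneg (hμ x).le (abs_nonneg (φ x))
        nlinarith
      refine h3.trans ?_
      rcases le_total 0 (φ x) with h | h
      · rw [abs_of_nonneg h, ← h2]
        exact Finset.sum_le_sum fun y _ => mul_le_mul_of_nonneg_left
          (by linarith [le_abs_self (φ y)]) (hG.nonneg x y)
      · rw [abs_of_nonpos h]
        have : -(l * (μ x * -φ x)) = ∑ y ∈ Ω, ω x y * (-φ y - -φ x) := by
          calc -(l * (μ x * -φ x)) = -∑ y ∈ Ω, ω x y * (φ y - φ x) := by rw [h2]; ring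
            _ = _ := by
              rw [← Finset.sum_neg_distrib]
              exact Finset.sum_congr rfl fun y _ => by ring
        rw [this]
        exact Finset.sum_le_sum fun y _ => mul_le_mul_of_nonneg_left
          (by linarith [neg_le_abs (φ y)]) (hG.nonneg x y)
    · exact hzero (hφout x hx)
  set S := ∑ x ∈ Ω, μ x * |φ x| with hS
  have hSpos : 0 < S := by
    obtain ⟨x, hx⟩ := Function.ne_iff.1 hφ0
    have hxΩ : x ∈ Ω := by
      by_contra h
      exact hx (hφout x fun h' => h h'.1)
    exact Finset.sum_pos' (fun y _ => mul_nonneg (hμ y).le (abs_nonneg _))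
      ⟨x, hxΩ, mul_pos (hμ x) (abs_pos.2 hx)⟩
  refine ⟨fun x => μ x * |φ x| / S,
    fun x => div_nonneg (mul_nonneg (hμ x).le (abs_nonneg _)) hSpos.le, ?_, ?_⟩
  · rw [← Finset.sum_div, ← hS, div_self hSpos.ne']
  · intro u hu
    have key : -ε * ∑ x ∈ Ω, μ x * |φ x| * u x ≤ ∑ x ∈ Ω, μ x * |φ x| * graphLap ω μ u x := by
      have e1 : ∑ x ∈ Ω, μ x * |φ x| * graphLap ω μ u x
          = ∑ x ∈ Ω, ∑ y ∈ Ω, |φ x| * (ω x y * (u y - u x)) := by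
        refine Finset.sum_congr rfl fun x _ => ?_
        rw [← Finset.mul_sum]
        by_cases hx : x ∈ finInterior ω Ω
        · rw [graphLap_eq_sum hG.nonneg μ u x Ω hx.2]
          have := (hμ x).ne'
          field_simp
        · simp [hφout x hx]
      have e2 : ∑ x ∈ Ω, ∑ y ∈ Ω, |φ x| * (ω x y * u y)
          = ∑ x ∈ Ω, ∑ y ∈ Ω, |φ y| * (ω x y * u x) := by
        rw [Finset.sum_comm]
        exact Finset.sum_congr rfl fun x _ => Finset.sum_congr rfl fun y _ => by rw [hG.symm y x]
      have e3 : ∑ x ∈ Ω, ∑ y ∈ Ω, |φ x| * (ω x y * (u y - u x))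
          = ∑ x ∈ Ω, u x * ∑ y ∈ Ω, ω x y * (|φ y| - |φ x|) := by
        simp only [mul_sub, Finset.sum_sub_distrib, e2, Finset.mul_sum]
        congr 1 <;>
          exact Finset.sum_congr rfl fun x _ => Finset.sum_congr rfl fun y _ => by ring
      rw [e1, e3, Finset.mul_sum]
      refine Finset.sum_le_sum fun x hx => ?_
      have := mul_le_mul_of_nonneg_left (hkato x hx) (hu x)
      linarith
    have h1 : ∀ f : V → ℝ, ∑ x ∈ Ω, μ x * |φ x| / S * f x = (∑ x ∈ Ω, μ x * |φ x| * f x) / S := by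
      intro f
      rw [Finset.sum_div]
      exact Finset.sum_congr rfl fun x _ => by ring
    rw [h1, h1, ← mul_div_assoc]
    gcongr

/-- A nonnegative function with `F' ≥ F ^ p - ε F` blows up in finite time. -/
theorem blowup_time_bound {p ε T : ℝ} (hp : 1 < p) (hε : 0 ≤ ε) {F F' : ℝ → ℝ}
    (hFc : ContinuousOn F (Icc 0 T)) (hF0 : 0 < F 0) (hFn : ∀ t ∈ Ioo 0 T, 0 ≤ F t)
    (hFd : ∀ t ∈ Ioo 0 T, HasDerivAt F (F' t) t)
    (hF' : ∀ t ∈ Ioo 0 T, -ε * F t + F t ^ p ≤ F' t) (hT : 0 < T) :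
    (p - 1) * Real.exp (-(ε * (p - 1) * T)) * T ≤ F 0 ^ (1 - p) := by
  let H : ℝ → ℝ := fun t => Real.exp (ε * t) * F t
  have hHc : ContinuousOn H (Icc 0 T) := by
    exact ContinuousOn.mul (by fun_prop) hFc
  have hHd : ∀ t ∈ Ioo 0 T, HasDerivAt H (Real.exp (ε * t) * (ε * F t + F' t)) t := by
    intro t ht
    have h1 : HasDerivAt (fun t => Real.exp (ε * t)) (Real.exp (ε * t) * (ε * 1)) t :=
      ((hasDerivAt_id t).const_mul ε).exp
    exact (h1.mul (hFd t ht)).congr_deriv (by ring)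
  have hHd' : ∀ t ∈ Ioo 0 T, Real.exp (ε * t) * F t ^ p ≤ Real.exp (ε * t) * (ε * F t + F' t) :=
    fun t ht => mul_le_mul_of_nonneg_left (by linarith [hF' t ht]) (Real.exp_pos _).le
  have hmono : MonotoneOn H (Icc 0 T) := by
    refine monotoneOn_of_deriv_nonneg (convex_Icc 0 T) hHc ?_ ?_
    · rw [interior_Icc]
      exact fun t ht => (hHd t ht).differentiableAt.differentiableWithinAt
    · rw [interior_Icc]
      intro t ht
      rw [(hHd t ht).deriv]
      exact le_trans (mul_nonneg (Real.exp_pos _).le (Real.rpow_nonneg (hFn t ht) _)) (hHd' t ht)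
  have hH0 : H 0 = F 0 := by simp [H]
  have hHpos : ∀ t ∈ Icc 0 T, 0 < H t := fun t ht =>
    (hH0 ▸ hF0).trans_le (hmono (left_mem_Icc.2 hT.le) ht ht.1)
  have hgd : ∀ t ∈ Ioo 0 T, HasDerivAt (fun t => H t ^ (1 - p))
      (Real.exp (ε * t) * (ε * F t + F' t) * (1 - p) * H t ^ (1 - p - 1)) t := fun t ht =>
    (hHd t ht).rpow_const (Or.inl (hHpos t (Ioo_subset_Icc_self ht)).ne')
  have := Convex.image_sub_le_mul_sub_of_deriv_le (convex_Icc 0 T) (f := fun t => H t ^ (1 - p))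
    (hHc.rpow_const fun t ht => Or.inl (hHpos t ht).ne')
    (by
      rw [interior_Icc]
      exact fun t ht => (hgd t ht).differentiableAt.differentiableWithinAt)
    (C := -((p - 1) * Real.exp (-(ε * (p - 1) * T))))
    (by
      rw [interior_Icc]
      intro t ht
      rw [(hgd t ht).deriv]
      have hHt := hHpos t (Ioo_subset_Icc_self ht)
      have hFt : 0 < F t := by
        have := hHt
        exact (mul_pos_iff_of_pos_left (Real.exp_pos _)).1 this
      have h1 : H t ^ (1 - p - 1) = Real.exp (-(ε * t * p)) * F t ^ (-p) := by
        rw [show 1 - p - 1 = -p by ring, Real.mul_rpow (Real.exp_pos _).le hFt.le, ← Real.exp_mul]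
        ring_nf
      have h2 : Real.exp (-(ε * (p - 1) * T)) ≤ Real.exp (ε * t) * F t ^ p * H t ^ (1 - p - 1) := by
        have h3 : F t ^ p * F t ^ (-p) = 1 := by
          rw [← Real.rpow_add hFt]; simp
        calc Real.exp (-(ε * (p - 1) * T)) ≤ Real.exp (-(ε * (p - 1) * t)) := by
              apply Real.exp_le_exp.2
              have : ε * (p - 1) * t ≤ ε * (p - 1) * T :=
                mul_le_mul_of_nonneg_left ht.2.le (mul_nonneg hε (by linarith))
              linarith
          _ = Real.exp (ε * t) * Real.exp (-(ε * t * p)) * (F t ^ p * F t ^ (-p)) := by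
              rw [h3, ← Real.exp_add]; ring_nf
          _ = _ := by rw [h1]; ring
      have h4 : Real.exp (ε * t) * F t ^ p * H t ^ (1 - p - 1)
          ≤ Real.exp (ε * t) * (ε * F t + F' t) * H t ^ (1 - p - 1) :=
        mul_le_mul_of_nonneg_right (hHd' t ht) (Real.rpow_nonneg hHt.le _)
      have h5 := mul_le_mul_of_nonneg_left (h2.trans h4) (by linarith : 0 ≤ p - 1)
      linarith)
    0 (left_mem_Icc.2 hT.le) T (right_mem_Icc.2 hT.le) hT.le
  simp only [hH0] at this
  have h6 := Real.rpow_nonneg (hHpos T (right_mem_Icc.2 hT.le)).le (1 - p)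
  linarith

/-- Every solution lives at most as long as the spatially constant one with datum `lam * c`. -/
theorem IsHeatSol.time_le {V : Type*} {ω : V → V → ℝ} {μ : V → ℝ}
    (hG : IsWeightedGraph ω μ) {p : ℝ} (hp : 1 < p) {ψ : V → ℝ} {xt : V} {c : ℝ} (hc : 0 < c)
    (hlim : ∀ ε > (0:ℝ), ∃ R : ℕ, ∀ x, R ≤ graphDist ω xt x → |ψ x - c| < ε)
    (hEC : EigenCond ω μ xt) {lam : ℝ} (hlam : 0 < lam) {T : ℝ} {u : V → ℝ → ℝ}
    (hu : IsHeatSol (graphLap ω μ) p (fun x => lam * ψ x) T u) :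
    T ≤ (lam * c) ^ (1 - p) / (p - 1) := by
  have hp1 : 0 < p - 1 := by linarith
  have hq : 0 < (lam * c) ^ (1 - p) / (p - 1) := by positivity
  refine le_of_forall_lt fun S hS => ?_
  rcases le_or_gt S 0 with hS0 | hS0
  · exact hS0.trans_lt hq
  obtain ⟨T', hST, hT'T⟩ := exists_between hS
  have hT' : 0 < T' := hS0.trans hST
  refine hST.trans_le ?_
  have main : ∀ ε ∈ Ioo 0 c,
      (p - 1) * Real.exp (-(ε * (p - 1) * T')) * T' ≤ (lam * (c - ε)) ^ (1 - p) := by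
    intro ε hε
    obtain ⟨R, hR⟩ := hlim ε hε.1
    obtain ⟨Ω, -, hne, hl, hfar⟩ := hEC ε hε.1 (R + 1) (by positivity)
    obtain ⟨w, hw0, hw1, hw⟩ := exists_weight hG Ω hne ε hl
    have hIco : ∀ t ∈ Ioo 0 T', t ∈ Ico 0 T := fun t ht => ⟨ht.1.le, ht.2.trans hT'T⟩
    have hψ : ∀ x ∈ Ω, c - ε ≤ ψ x := by
      intro x hx
      have h1 : R ≤ graphDist ω xt x := by
        have := hfar x hx
        have h2 : (R : ℝ) ≤ graphDist ω xt x := by linarith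
        exact_mod_cast h2
      linarith [(abs_lt.1 (hR x h1)).1]
    have hF0 : lam * (c - ε) ≤ ∑ x ∈ Ω, w x * u x 0 := by
      calc lam * (c - ε) = ∑ x ∈ Ω, w x * (lam * (c - ε)) := by rw [← Finset.sum_mul, hw1, one_mul]
        _ ≤ _ := Finset.sum_le_sum fun x hx => by
          rw [hu.init x]
          exact mul_le_mul_of_nonneg_left (mul_le_mul_of_nonneg_left (hψ x hx) hlam.le) (hw0 x)
    have hpos : 0 < lam * (c - ε) := mul_pos hlam (by linarith [hε.2])
    refine (blowup_time_bound hp hε.1.le (F := fun t => ∑ x ∈ Ω, w x * u x t)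
      (F' := fun t => ∑ x ∈ Ω, w x * (graphLap ω μ (fun y => u y t) x + u x t ^ p))
      ?_ (hpos.trans_le hF0) ?_ ?_ ?_ hT').trans
      (Real.rpow_le_rpow_of_nonpos hpos hF0 (by linarith))
    · refine continuousOn_finsetSum _ fun x _ => continuousOn_const.mul ?_
      exact (hu.cont x).mono fun t ht => ⟨ht.1, ht.2.trans_lt hT'T⟩
    · exact fun t ht => Finset.sum_nonneg fun x _ =>
        mul_nonneg (hw0 x) (hu.nonneg x t (hIco t ht))
    · intro t ht
      exact HasDerivAt.fun_sum fun x _ => (hu.eqn x t ⟨ht.1, ht.2.trans hT'T⟩).const_mul (w x)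
    · intro t ht
      simp only [mul_add, Finset.sum_add_distrib]
      exact add_le_add (hw (fun y => u y t) fun x => hu.nonneg x t (hIco t ht))
        (Real.rpow_arith_mean_le_arith_mean_rpow Ω w (fun x => u x t) (fun x _ => hw0 x) hw1
          (fun x _ => hu.nonneg x t (hIco t ht)) hp.le)
  have hlim1 : Tendsto (fun ε : ℝ => (p - 1) * Real.exp (-(ε * (p - 1) * T')) * T') (𝓝[>] 0)
      (𝓝 ((p - 1) * T')) := by
    have : Continuous fun ε : ℝ => (p - 1) * Real.exp (-(ε * (p - 1) * T')) * T' := by fun_prop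
    have h := this.tendsto 0
    simp only [zero_mul, neg_zero, Real.exp_zero, mul_one] at h
    exact h.mono_left nhdsWithin_le_nhds
  have hlim2 : Tendsto (fun ε : ℝ => (lam * (c - ε)) ^ (1 - p)) (𝓝[>] 0)
      (𝓝 ((lam * c) ^ (1 - p))) := by
    have : ContinuousAt (fun ε : ℝ => (lam * (c - ε)) ^ (1 - p)) 0 := by
      refine ContinuousAt.rpow_const (by fun_prop) (Or.inl ?_)
      simp [hlam.ne', hc.ne']
    have h := this.tendsto
    simp only [sub_zero] at h
    exact h.mono_left nhdsWithin_le_nhds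
  have hle := le_of_tendsto_of_tendsto hlim1 hlim2
    (Filter.mem_of_superset (Ioo_mem_nhdsGT hc) main)
  rw [le_div_iff₀ hp1]
  linarith

theorem graphLap_const {V : Type*} (ω : V → V → ℝ) (μ : V → ℝ) (c : ℝ) (x : V) :
    graphLap ω μ (fun _ => c) x = 0 := by
  simp [graphLap]

theorem graphLap_add_mul_mono {V : Type*} {ω : V → V → ℝ} {μ : V → ℝ}
    (hG : IsWeightedGraph ω μ) {K : ℝ} (hK : ∀ x, (∑' y, ω x y) ≤ K * μ x) {u v : V → ℝ}
    (huv : ∀ x, u x ≤ v x) (x : V) :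
    graphLap ω μ u x + K * u x ≤ graphLap ω μ v x + K * v x := by
  have hs : ∀ y, 0 < ω x y → y ∈ (hG.locallyFinite x).toFinset := fun y hy => by simpa using hy
  have hm : ∑ y ∈ (hG.locallyFinite x).toFinset, ω x y ≤ K * μ x := by
    refine le_of_eq_of_le (tsum_eq_sum fun y hy => ?_).symm (hK x)
    exact le_antisymm (not_lt.1 fun h => hy (hs y h)) (hG.nonneg x y)
  have hμ := hG.measurePos x
  rw [graphLap_eq_sum hG.nonneg μ u x _ hs, graphLap_eq_sum hG.nonneg μ v x _ hs]
  have h1 : ∑ y ∈ (hG.locallyFinite x).toFinset, ω x y * (u y - u x)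
      ≤ ∑ y ∈ (hG.locallyFinite x).toFinset, (ω x y * (v y - v x) + ω x y * (v x - u x)) :=
    Finset.sum_le_sum fun y _ => by
      have := mul_le_mul_of_nonneg_left (huv y) (hG.nonneg x y)
      linarith
  rw [Finset.sum_add_distrib, ← Finset.sum_mul] at h1
  have h2 := mul_le_mul_of_nonneg_right hm (sub_nonneg.2 (huv x))
  have h3 := mul_le_mul_of_nonneg_left (h1.trans (add_le_add_right h2 _)) (one_div_pos.2 hμ).le
  have h4 : 1 / μ x * (K * μ x * (v x - u x)) = K * (v x - u x) := by
    field_simp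
  rw [mul_add, h4] at h3
  linarith

/-- The integrand of the Duhamel formula for `u_t = Δu + u ^ p`, after adding `K u` to both
sides to make the linear part order preserving. -/
def duhamelSource {V : Type*} (ω : V → V → ℝ) (μ : V → ℝ) (K p : ℝ) (u : V → ℝ → ℝ) (x : V)
    (s : ℝ) : ℝ :=
  Real.exp (K * s) * (graphLap ω μ (fun y => u y s) x + K * u x s + u x s ^ p)

/-- The Picard map whose fixed points are the mild solutions of `u_t = Δu + u ^ p`. -/
def duhamelMap {V : Type*} (ω : V → V → ℝ) (μ : V → ℝ) (K p : ℝ) (ψ0 : V → ℝ)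
    (u : V → ℝ → ℝ) (x : V) (t : ℝ) : ℝ :=
  Real.exp (-(K * t)) * (ψ0 x + ∫ s in (0:ℝ)..t, duhamelSource ω μ K p u x s)

section Duhamel

variable {V : Type*} {ω : V → V → ℝ} {μ : V → ℝ} {K p T : ℝ}

theorem continuousOn_duhamelSource (hG : IsWeightedGraph ω μ) (hp : 0 ≤ p) {u : V → ℝ → ℝ}
    {S : Set ℝ} (hu : ∀ x, ContinuousOn (u x) S) (x : V) :
    ContinuousOn (duhamelSource ω μ K p u x) S := by
  have hs : ∀ y, 0 < ω x y → y ∈ (hG.locallyFinite x).toFinset := fun y hy => by simpa using hy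
  have hL : ContinuousOn (fun s => graphLap ω μ (fun y => u y s) x) S := by
    simp only [graphLap_eq_sum hG.nonneg μ _ x _ hs]
    exact continuousOn_const.mul (continuousOn_finsetSum _ fun y _ =>
      continuousOn_const.mul ((hu y).sub (hu x)))
  exact ContinuousOn.mul (by fun_prop) ((hL.add (continuousOn_const.mul (hu x))).add
    ((hu x).rpow_const fun _ _ => Or.inr hp))

theorem tendsto_duhamelSource (hG : IsWeightedGraph ω μ) (hp : 0 ≤ p) {u : ℕ → V → ℝ → ℝ}
    {v : V → ℝ → ℝ} {s : ℝ} (h : ∀ y, Tendsto (fun n => u n y s) atTop (𝓝 (v y s))) (x : V) :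
    Tendsto (fun n => duhamelSource ω μ K p (u n) x s) atTop
      (𝓝 (duhamelSource ω μ K p v x s)) := by
  have hs : ∀ y, 0 < ω x y → y ∈ (hG.locallyFinite x).toFinset := fun y hy => by simpa using hy
  have hL : Tendsto (fun n => graphLap ω μ (fun y => u n y s) x) atTop
      (𝓝 (graphLap ω μ (fun y => v y s) x)) := by
    simp only [graphLap_eq_sum hG.nonneg μ _ x _ hs]
    exact (tendsto_finsetSum _ fun y _ => ((h y).sub (h x)).const_mul _).const_mul _
  exact ((hL.add ((h x).const_mul K)).add ((h x).rpow_const (Or.inr hp))).const_mul _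

theorem duhamelSource_mono (hG : IsWeightedGraph ω μ) (hK : ∀ x, (∑' y, ω x y) ≤ K * μ x)
    (hp : 0 ≤ p) {u v : V → ℝ → ℝ} {s : ℝ} (hu : ∀ x, 0 ≤ u x s) (huv : ∀ x, u x s ≤ v x s)
    (x : V) : duhamelSource ω μ K p u x s ≤ duhamelSource ω μ K p v x s :=
  mul_le_mul_of_nonneg_left (add_le_add (graphLap_add_mul_mono hG hK huv x)
    (Real.rpow_le_rpow (hu x) (huv x) hp)) (Real.exp_pos _).le

theorem duhamelSource_nonneg (hG : IsWeightedGraph ω μ) (hK : ∀ x, (∑' y, ω x y) ≤ K * μ x)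
    (hp : 0 < p) {u : V → ℝ → ℝ} {s : ℝ} (hu : ∀ x, 0 ≤ u x s) (x : V) :
    0 ≤ duhamelSource ω μ K p u x s := by
  have h := duhamelSource_mono (u := fun _ _ => 0) (s := s) hG hK hp.le (fun _ => le_rfl) hu x
  simpa [duhamelSource, graphLap_const, Real.zero_rpow hp.ne'] using h

theorem uIcc_subset_Ico {t : ℝ} (ht : t ∈ Ico 0 T) : uIcc 0 t ⊆ Ico 0 T := by
  rw [uIcc_of_le ht.1]
  exact fun s hs => ⟨hs.1, hs.2.trans_lt ht.2⟩

theorem intervalIntegrable_duhamelSource (hG : IsWeightedGraph ω μ) (hp : 0 ≤ p)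
    {u : V → ℝ → ℝ} (hu : ∀ x, ContinuousOn (u x) (Ico 0 T)) (x : V) {t : ℝ} (ht : t ∈ Ico 0 T) :
    IntervalIntegrable (duhamelSource ω μ K p u x) MeasureTheory.volume 0 t :=
  ((continuousOn_duhamelSource hG hp hu x).mono (uIcc_subset_Ico ht)).intervalIntegrable

theorem continuousOn_duhamelMap_of_integrable {ψ0 : V → ℝ} {u : V → ℝ → ℝ} (x : V)
    (h : ∀ t ∈ Ico 0 T,
      IntervalIntegrable (duhamelSource ω μ K p u x) MeasureTheory.volume 0 t) :
    ContinuousOn (duhamelMap ω μ K p ψ0 u x) (Ico 0 T) := by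
  refine ContinuousOn.mul (by fun_prop) (continuousOn_const.add fun t ht => ?_)
  obtain ⟨t', htt', ht'T⟩ := exists_between ht.2
  have ht'0 : 0 ≤ t' := ht.1.trans htt'.le
  have h1 := intervalIntegral.continuousOn_primitive_interval
    ((intervalIntegrable_iff' (a := 0) (b := t')).1 (h t' ⟨ht'0, ht'T⟩))
  rw [uIcc_of_le ht'0] at h1
  refine (h1 t ⟨ht.1, htt'.le⟩).mono_of_mem_nhdsWithin ?_
  filter_upwards [self_mem_nhdsWithin, mem_nhdsWithin_of_mem_nhds (Iio_mem_nhds htt')]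
    with s hs hs' using ⟨hs.1, le_of_lt hs'⟩

theorem duhamelMap_mono (hG : IsWeightedGraph ω μ) (hK : ∀ x, (∑' y, ω x y) ≤ K * μ x)
    (hp : 0 ≤ p) {ψ0 ψ1 : V → ℝ} (hψ : ∀ x, ψ0 x ≤ ψ1 x) {u v : V → ℝ → ℝ}
    (huc : ∀ x, ContinuousOn (u x) (Ico 0 T)) (hvc : ∀ x, ContinuousOn (v x) (Ico 0 T))
    (hu : ∀ x, ∀ t ∈ Ico 0 T, 0 ≤ u x t) (huv : ∀ x, ∀ t ∈ Ico 0 T, u x t ≤ v x t)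
    (x : V) {t : ℝ} (ht : t ∈ Ico 0 T) :
    duhamelMap ω μ K p ψ0 u x t ≤ duhamelMap ω μ K p ψ1 v x t := by
  refine mul_le_mul_of_nonneg_left (add_le_add (hψ x) ?_) (Real.exp_pos _).le
  refine intervalIntegral.integral_mono_on ht.1 (intervalIntegrable_duhamelSource hG hp huc x ht)
    (intervalIntegrable_duhamelSource hG hp hvc x ht) fun s hs => ?_
  have hs' : s ∈ Ico 0 T := ⟨hs.1, hs.2.trans_lt ht.2⟩
  exact duhamelSource_mono hG hK hp (fun y => hu y s hs') (fun y => huv y s hs') x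

/-- A spatially constant solution is a fixed point of the Duhamel map. -/
theorem duhamelMap_const (hp : 0 ≤ p) {z : ℝ → ℝ}
    (hz : ∀ t ∈ Ico 0 T, HasDerivAt z (z t ^ p) t) (x : V) {t : ℝ} (ht : t ∈ Ico 0 T) :
    duhamelMap ω μ K p (fun _ => z 0) (fun _ => z) x t = z t := by
  have hzc : ContinuousOn z (Ico 0 T) := fun t ht => (hz t ht).continuousAt.continuousWithinAt
  have h1 : ∫ s in (0:ℝ)..t, duhamelSource ω μ K p (fun _ => z) x s
      = Real.exp (K * t) * z t - Real.exp (K * 0) * z 0 := by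
    refine intervalIntegral.integral_eq_sub_of_hasDerivAt (f := fun s => Real.exp (K * s) * z s)
      (fun s hs => ?_) ?_
    · have h2 : HasDerivAt (fun s => Real.exp (K * s)) (Real.exp (K * s) * (K * 1)) s :=
        ((hasDerivAt_id s).const_mul K).exp
      refine (h2.mul (hz s (uIcc_subset_Ico ht hs))).congr_deriv ?_
      rw [duhamelSource, graphLap_const]
      ring
    · refine ContinuousOn.intervalIntegrable ?_
      have h3 : ContinuousOn (fun s => Real.exp (K * s) * (0 + K * z s + z s ^ p)) (Ico 0 T) :=
        ContinuousOn.mul (by fun_prop) ((continuousOn_const.add (continuousOn_const.mul hzc)).add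
          (hzc.rpow_const fun _ _ => Or.inr hp))
      refine (h3.mono (uIcc_subset_Ico ht)).congr fun s _ => ?_
      rw [duhamelSource, graphLap_const]
  rw [duhamelMap, h1, mul_zero, Real.exp_zero, one_mul, add_sub_cancel, ← mul_assoc,
    ← Real.exp_add, neg_add_cancel, Real.exp_zero, one_mul]

/-- A continuous bounded-by-`z` fixed point of the Duhamel map is a classical solution. -/
theorem isHeatSol_of_duhamelMap_eq (hG : IsWeightedGraph ω μ) (hp : 0 ≤ p) {ψ0 : V → ℝ}
    (hT : 0 < T) {z : ℝ → ℝ} (hzc : ContinuousOn z (Ico 0 T)) {u : V → ℝ → ℝ}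
    (huc : ∀ x, ContinuousOn (u x) (Ico 0 T)) (hu0 : ∀ x, ∀ t ∈ Ico 0 T, 0 ≤ u x t)
    (huz : ∀ x, ∀ t ∈ Ico 0 T, u x t ≤ z t)
    (hfix : ∀ x, ∀ t ∈ Ico 0 T, u x t = duhamelMap ω μ K p ψ0 u x t) :
    IsHeatSol (graphLap ω μ) p ψ0 T u where
  nonneg := hu0
  cont := huc
  bounded := by
    intro T' hT'
    obtain ⟨C, hC⟩ := (isCompact_Icc (a := (0:ℝ)) (b := T')).exists_bound_of_continuousOn
      (hzc.mono fun t ht => ⟨ht.1, ht.2.trans_lt hT'.2⟩)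
    refine ⟨C, fun x t ht => ?_⟩
    have ht' : t ∈ Ico 0 T := ⟨ht.1, ht.2.trans_lt hT'.2⟩
    rw [abs_of_nonneg (hu0 x t ht')]
    exact (huz x t ht').trans ((le_abs_self _).trans (hC t ht))
  eqn := by
    intro x t ht
    have hc := continuousOn_duhamelSource (K := K) hG hp huc x
    have hnhds : Ioo 0 T ∈ 𝓝 t := Ioo_mem_nhds ht.1 ht.2
    have hd : HasDerivAt (fun r => ∫ s in (0:ℝ)..r, duhamelSource ω μ K p u x s)
        (duhamelSource ω μ K p u x t) t :=
      intervalIntegral.integral_hasDerivAt_right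
        (intervalIntegrable_duhamelSource hG hp huc x (Ioo_subset_Ico_self ht))
        ((hc.mono Ioo_subset_Ico_self).stronglyMeasurableAtFilter isOpen_Ioo t ht)
        ((hc.mono Ioo_subset_Ico_self).continuousAt hnhds)
    have he : HasDerivAt (fun r => Real.exp (-(K * r))) (Real.exp (-(K * t)) * -(K * 1)) t :=
      ((hasDerivAt_id t).const_mul K).neg.exp
    have hmain := he.mul (hd.const_add (ψ0 x))
    have heq : u x =ᶠ[𝓝 t] fun r => Real.exp (-(K * r)) *
        (ψ0 x + ∫ s in (0:ℝ)..r, duhamelSource ω μ K p u x s) := by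
      filter_upwards [hnhds] with r hr using hfix x r (Ioo_subset_Ico_self hr)
    refine (hmain.congr_of_eventuallyEq heq).congr_deriv ?_
    have hut := hfix x t (Ioo_subset_Ico_self ht)
    rw [duhamelMap] at hut
    have hexp : Real.exp (-(K * t)) * Real.exp (K * t) = 1 := by
      rw [← Real.exp_add, neg_add_cancel, Real.exp_zero]
    calc Real.exp (-(K * t)) * -(K * 1) *
          (ψ0 x + ∫ s in (0:ℝ)..t, duhamelSource ω μ K p u x s)
          + Real.exp (-(K * t)) * duhamelSource ω μ K p u x t
        = -K * (Real.exp (-(K * t)) * (ψ0 x + ∫ s in (0:ℝ)..t, duhamelSource ω μ K p u x s))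
          + Real.exp (-(K * t)) * Real.exp (K * t) *
            (graphLap ω μ (fun y => u y t) x + K * u x t + u x t ^ p) := by
          rw [duhamelSource]; ring
      _ = graphLap ω μ (fun y => u y t) x + u x t ^ p := by
          rw [← hut, hexp]; ring
  init := fun x => by
    rw [hfix x 0 ⟨le_rfl, hT⟩]
    simp [duhamelMap]

/-- Monotone iteration below a spatially constant solution produces a solution. -/
theorem exists_isHeatSol_of_le_const (hG : IsWeightedGraph ω μ)
    (hK : ∀ x, (∑' y, ω x y) ≤ K * μ x) (hp : 0 < p) {ψ0 : V → ℝ} (hψ0 : ∀ x, 0 ≤ ψ0 x)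
    (hT : 0 < T) {z : ℝ → ℝ} (hz0 : ∀ t ∈ Ico 0 T, 0 ≤ z t)
    (hz : ∀ t ∈ Ico 0 T, HasDerivAt z (z t ^ p) t) (hψz : ∀ x, ψ0 x ≤ z 0) :
    ∃ u, IsHeatSol (graphLap ω μ) p ψ0 T u := by
  have hzc : ContinuousOn z (Ico 0 T) := fun t ht => (hz t ht).continuousAt.continuousWithinAt
  let U : ℕ → V → ℝ → ℝ := fun n => (duhamelMap ω μ K p ψ0)^[n] fun _ _ => 0
  have hU0 : U 0 = fun _ _ => 0 := rfl
  have hUs : ∀ n, U (n + 1) = duhamelMap ω μ K p ψ0 (U n) := fun n =>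
    Function.iterate_succ_apply' _ _ _
  have hUc : ∀ n x, ContinuousOn (U n x) (Ico 0 T) := by
    intro n
    induction n with
    | zero => exact fun x => continuousOn_const
    | succ n ih =>
      intro x
      rw [hUs]
      exact continuousOn_duhamelMap_of_integrable x fun t ht =>
        intervalIntegrable_duhamelSource hG hp.le ih x ht
  have hUnn : ∀ n x, ∀ t ∈ Ico 0 T, 0 ≤ U n x t := by
    intro n
    induction n with
    | zero => exact fun x t _ => le_rfl
    | succ n ih =>
      intro x t ht
      rw [hUs]
      refine mul_nonneg (Real.exp_pos _).le (add_nonneg (hψ0 x) ?_)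
      refine intervalIntegral.integral_nonneg ht.1 fun s hs => ?_
      exact duhamelSource_nonneg hG hK hp (fun y => ih y s ⟨hs.1, hs.2.trans_lt ht.2⟩) x
  have hUmono : ∀ n x, ∀ t ∈ Ico 0 T, U n x t ≤ U (n + 1) x t := by
    intro n
    induction n with
    | zero => exact fun x t ht => hUnn 1 x t ht
    | succ n ih =>
      intro x t ht
      rw [hUs n, hUs (n + 1)]
      exact duhamelMap_mono hG hK hp.le (fun _ => le_rfl) (hUc n) (hUc (n + 1)) (hUnn n) ih x ht
  have hUz : ∀ n x, ∀ t ∈ Ico 0 T, U n x t ≤ z t := by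
    intro n
    induction n with
    | zero => exact fun x t ht => hz0 t ht
    | succ n ih =>
      intro x t ht
      rw [hUs, ← duhamelMap_const (ω := ω) (μ := μ) (K := K) hp.le hz x ht]
      exact duhamelMap_mono hG hK hp.le hψz (hUc n) (fun _ => hzc) (hUnn n) ih x ht
  let u : V → ℝ → ℝ := fun x t => ⨆ n, U n x t
  have hlim : ∀ x, ∀ t ∈ Ico 0 T, Tendsto (fun n => U n x t) atTop (𝓝 (u x t)) :=
    fun x t ht => tendsto_atTop_ciSup (monotone_nat_of_le_succ fun n => hUmono n x t ht)
      ⟨z t, by rintro _ ⟨n, rfl⟩; exact hUz n x t ht⟩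
  have hunn : ∀ x, ∀ t ∈ Ico 0 T, 0 ≤ u x t := fun x t ht =>
    ge_of_tendsto' (hlim x t ht) fun n => hUnn n x t ht
  have huz : ∀ x, ∀ t ∈ Ico 0 T, u x t ≤ z t := fun x t ht =>
    le_of_tendsto' (hlim x t ht) fun n => hUz n x t ht
  have hmem : ∀ {t s : ℝ}, t ∈ Ico 0 T → s ∈ uIoc 0 t → s ∈ Ico 0 T := fun ht hs =>
    uIcc_subset_Ico ht (uIoc_subset_uIcc hs)
  have hmeas : ∀ n x, ∀ t ∈ Ico 0 T, MeasureTheory.AEStronglyMeasurable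
      (duhamelSource ω μ K p (U n) x) (MeasureTheory.volume.restrict (uIoc 0 t)) :=
    fun n x t ht =>
      (intervalIntegrable_duhamelSource hG hp.le (hUc n) x ht).def'.aestronglyMeasurable
  have hslim : ∀ x, ∀ s ∈ Ico 0 T, Tendsto (fun n => duhamelSource ω μ K p (U n) x s) atTop
      (𝓝 (duhamelSource ω μ K p u x s)) := fun x s hs =>
    tendsto_duhamelSource hG hp.le (fun y => hlim y s hs) x
  have hint : ∀ x, ∀ t ∈ Ico 0 T,
      IntervalIntegrable (duhamelSource ω μ K p u x) MeasureTheory.volume 0 t := by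
    intro x t ht
    refine (intervalIntegrable_duhamelSource (K := K) hG hp.le (u := fun _ => z)
      (fun _ => hzc) x ht).mono_fun'
      (aestronglyMeasurable_of_tendsto_ae atTop (fun n => hmeas n x t ht) ?_) ?_
    · filter_upwards [MeasureTheory.ae_restrict_mem measurableSet_uIoc] with s hs
        using hslim x s (hmem ht hs)
    · filter_upwards [MeasureTheory.ae_restrict_mem measurableSet_uIoc] with s hs
      have hs' := hmem ht hs
      rw [Real.norm_of_nonneg (duhamelSource_nonneg hG hK hp (fun y => hunn y s hs') x)]
      exact duhamelSource_mono hG hK hp.le (fun y => hunn y s hs') (fun y => huz y s hs') x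
  have hfix : ∀ x, ∀ t ∈ Ico 0 T, u x t = duhamelMap ω μ K p ψ0 u x t := by
    intro x t ht
    have h1 : Tendsto (fun n => ∫ s in (0:ℝ)..t, duhamelSource ω μ K p (U n) x s) atTop
        (𝓝 (∫ s in (0:ℝ)..t, duhamelSource ω μ K p u x s)) := by
      refine intervalIntegral.tendsto_integral_filter_of_dominated_convergence
        (duhamelSource ω μ K p (fun _ => z) x) (Eventually.of_forall fun n => hmeas n x t ht)
        (Eventually.of_forall fun n => Eventually.of_forall fun s hs => ?_)
        (intervalIntegrable_duhamelSource hG hp.le (fun _ => hzc) x ht)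
        (Eventually.of_forall fun s hs => hslim x s (hmem ht hs))
      have hs' := hmem ht hs
      rw [Real.norm_of_nonneg (duhamelSource_nonneg hG hK hp (fun y => hUnn n y s hs') x)]
      exact duhamelSource_mono hG hK hp.le (fun y => hUnn n y s hs') (fun y => hUz n y s hs') x
    have h2 : Tendsto (fun n => U (n + 1) x t) atTop (𝓝 (duhamelMap ω μ K p ψ0 u x t)) := by
      simp only [hUs]
      exact (h1.const_add (ψ0 x)).const_mul _
    exact tendsto_nhds_unique ((tendsto_add_atTop_iff_nat 1).2 (hlim x t ht)) h2
  have huc : ∀ x, ContinuousOn (u x) (Ico 0 T) := fun x =>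
    (continuousOn_duhamelMap_of_integrable x (hint x)).congr fun t ht => hfix x t ht
  exact ⟨u, isHeatSol_of_duhamelMap_eq hG hp.le hT hzc huc hunn huz hfix⟩

end Duhamel

/-- The solution of `z' = z ^ p`, `z 0 = a`, lives up to time `a ^ (1 - p) / (p - 1)`. -/
theorem exists_isHeatSol_of_le {V : Type*} {ω : V → V → ℝ} {μ : V → ℝ}
    (hG : IsWeightedGraph ω μ) (hD : DmuFinite ω μ) {p : ℝ} (hp : 1 < p) {ψ0 : V → ℝ}
    (hψ0 : ∀ x, 0 ≤ ψ0 x) {a : ℝ} (ha : 0 < a) (hψa : ∀ x, ψ0 x ≤ a) :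
    ∃ u, IsHeatSol (graphLap ω μ) p ψ0 (a ^ (1 - p) / (p - 1)) u := by
  obtain ⟨K, hK⟩ := hD
  have hp1 : 0 < p - 1 := by linarith
  have hap : 0 < a ^ (1 - p) := Real.rpow_pos_of_pos ha _
  have hpos : ∀ t ∈ Ico 0 (a ^ (1 - p) / (p - 1)), 0 < a ^ (1 - p) - (p - 1) * t := by
    intro t ht
    have := (lt_div_iff₀ hp1).1 ht.2
    linarith
  refine exists_isHeatSol_of_le_const (K := K) hG hK (by linarith) hψ0 (div_pos hap hp1)
    (z := fun t => (a ^ (1 - p) - (p - 1) * t) ^ (-(1 / (p - 1))))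
    (fun t ht => Real.rpow_nonneg (hpos t ht).le _) (fun t ht => ?_) (fun x => ?_)
  · have h1 : HasDerivAt (fun t => a ^ (1 - p) - (p - 1) * t) (-((p - 1) * 1)) t :=
      ((hasDerivAt_id t).const_mul (p - 1)).const_sub _
    refine (h1.rpow_const (p := -(1 / (p - 1))) (Or.inl (hpos t ht).ne')).congr_deriv ?_
    rw [← Real.rpow_mul (hpos t ht).le]
    have h2 : -((p - 1) * 1) * -(1 / (p - 1)) = 1 := by field_simp
    have h3 : -(1 / (p - 1)) - 1 = -(1 / (p - 1)) * p := by field_simp; ring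
    rw [h2, h3, one_mul]
  · have h1 : (1 - p) * -(1 / (p - 1)) = 1 := by field_simp; ring
    simp only [mul_zero, sub_zero]
    rw [← Real.rpow_mul ha.le, h1, Real.rpow_one]
    exact hψa x

/-- Theorem 1.5(2): under `D_μ < ∞`, (EC) and `ψ(x) → ψ_∞ > 0` as
`d(x̃,x) → ∞`, if in addition `ψ ≤ ψ_∞` on `V`, then
`lim_{λ→0} λ^{p-1} T_λ = 1/((p-1) ψ_∞^{p-1})`. -/
theorem stmt3 {V : Type*} [Infinite V] [Countable V]
    (ω : V → V → ℝ) (μ : V → ℝ) (hG : IsWeightedGraph ω μ) (hD : DmuFinite ω μ)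
    (p : ℝ) (hp : 1 < p)
    (ψ : V → ℝ) (hψ0 : ∀ x, 0 ≤ ψ x) (hψbd : ∃ C : ℝ, ∀ x, ψ x ≤ C)
    (hψne : ∃ x, ψ x ≠ 0)
    (xt : V) (psiInf : ℝ) (hpsiInf : 0 < psiInf)
    (hlim : ∀ ε > (0:ℝ), ∃ R : ℕ, ∀ x, R ≤ graphDist ω xt x → |ψ x - psiInf| < ε)
    (hEC : EigenCond ω μ xt)
    (hle : ∀ x, ψ x ≤ psiInf) :
    Tendsto
      (fun lam : ℝ => ENNReal.ofReal (lam ^ (p - 1)) *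
        lifeSpan (graphLap ω μ) p (fun x => lam * ψ x))
      (𝓝[>] (0:ℝ))
      (𝓝 (ENNReal.ofReal (1 / ((p - 1) * psiInf ^ (p - 1))))) := by
  have hp1 : 0 < p - 1 := by linarith
  refine tendsto_const_nhds.congr' ?_
  filter_upwards [self_mem_nhdsWithin] with lam hlam
  have hlam : 0 < lam := hlam
  have ha : 0 < lam * psiInf := mul_pos hlam hpsiInf
  have hlife : lifeSpan (graphLap ω μ) p (fun x => lam * ψ x)
      = ENNReal.ofReal ((lam * psiInf) ^ (1 - p) / (p - 1)) := by
    apply le_antisymm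
    · refine iSup₂_le fun T hT => ?_
      obtain ⟨-, u, hu⟩ := hT
      exact ENNReal.ofReal_le_ofReal (hu.time_le hG hp hpsiInf hlim hEC hlam)
    · exact le_iSup₂_of_le ((lam * psiInf) ^ (1 - p) / (p - 1))
        ⟨div_pos (Real.rpow_pos_of_pos ha _) hp1,
          exists_isHeatSol_of_le hG hD hp (fun x => mul_nonneg hlam.le (hψ0 x)) ha
            fun x => mul_le_mul_of_nonneg_left (hle x) hlam.le⟩ le_rfl
  rw [hlife, ← ENNReal.ofReal_mul (Real.rpow_nonneg hlam.le _)]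
  congr 1
  rw [Real.mul_rpow hlam.le hpsiInf.le, show 1 - p = -(p - 1) by ring,
    Real.rpow_neg hlam.le, Real.rpow_neg hpsiInf.le]
  have h1 := (Real.rpow_pos_of_pos hlam (p - 1)).ne'
  have h2 := (Real.rpow_pos_of_pos hpsiInf (p - 1)).ne'
  field_simp
end
end

section
/- Let G=(V,E,ω,μ) be an infinite, locally finite, connected weighted graph with D_μ<∞, let p>1, and let ψ:V→[0,∞) be bounded with ψ≢0. Suppose there are a vertex x̃∈V and a constant ψ_∞>0 such that lim_{d(x̃,x)→∞} ψ(x) = ψ_∞ and G satisfies the eigenvalue condition (EC). Then 1/((p-1)‖ψ‖_{ℓ^∞(V)}^{p-1}) ≤ liminf_{λ→0} λ^{p-1} T_λ ≤ limsup_{λ→0} λ^{p-1} T_λ ≤ 1/((p-1) ψ_∞^{p-1}). -/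
open Filter Topology Set
open scoped ENNReal Classical

noncomputable section

section Laplacian

variable {V : Type*} {ω : V → V → ℝ} {μ : V → ℝ}

theorem tsum_weight_mul_eq_sum (hG : IsWeightedGraph ω μ) (x : V) (S : Finset V)
    (hS : ∀ y, 0 < ω x y → y ∈ S) (f : V → ℝ) :
    ∑' y, ω x y * f y = ∑ y ∈ S, ω x y * f y := by
  refine tsum_eq_sum fun y hy => ?_
  have h0 : ω x y = 0 := le_antisymm (not_lt.1 fun h => hy (hS y h)) (hG.nonneg x y)
  rw [h0, zero_mul]

theorem measure_mul_graphLap (hG : IsWeightedGraph ω μ) (x : V) (S : Finset V)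
    (hS : ∀ y, 0 < ω x y → y ∈ S) (u : V → ℝ) :
    μ x * graphLap ω μ u x = ∑ y ∈ S, ω x y * (u y - u x) := by
  rw [graphLap, tsum_weight_mul_eq_sum hG x S hS, ← mul_assoc,
    mul_one_div_cancel (hG.measurePos x).ne', one_mul]

/-- The Dirichlet problem on a finite set with nonempty interior has an eigenvalue. -/
theorem exists_dirichlet_eigenvalue (hG : IsWeightedGraph ω μ) (Ω : Finset V)
    (hΩ : (finInterior ω Ω).Nonempty) :
    ∃ (l : ℝ) (φ : V → ℝ), φ ≠ 0 ∧ (∀ x, x ∉ finInterior ω Ω → φ x = 0) ∧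
      ∀ x ∈ finInterior ω Ω, -graphLap ω μ φ x = l * φ x := by
  have hfin : (finInterior ω Ω).Finite := Ω.finite_toSet.subset fun x hx => hx.1
  let I := {x // x ∈ finInterior ω Ω}
  have : Fintype I := hfin.fintype
  obtain ⟨x₀, hx₀⟩ := hΩ
  let i₀ : I := ⟨x₀, hx₀⟩
  let s : V → ℝ := fun x => √(μ x)
  have hs : ∀ x, 0 < s x := fun x => Real.sqrt_pos.2 (hG.measurePos x)
  have hss : ∀ x, s x * s x = μ x := fun x => Real.mul_self_sqrt (hG.measurePos x).le
  let A : Matrix I I ℝ := Matrix.diagonal (fun x : I => (∑ z ∈ Ω, ω x z) / μ x) -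
    Matrix.of fun x y : I => ω x y / (s x * s y)
  have hA : A.IsHermitian := by
    refine (Matrix.isHermitian_diagonal _).sub (Matrix.IsHermitian.ext fun x y => ?_)
    rw [Matrix.of_apply, Matrix.of_apply, star_trivial, hG.symm y x, mul_comm (s y)]
  let v : I → ℝ := ⇑(hA.eigenvectorBasis i₀)
  have hv : A.mulVec v = hA.eigenvalues i₀ • v := hA.mulVec_eigenvectorBasis i₀
  have hv0 : v ≠ 0 := by
    intro h
    apply hA.eigenvectorBasis.orthonormal.ne_zero i₀
    ext j
    exact congrFun h j
  let φ : V → ℝ := fun x => if h : x ∈ finInterior ω Ω then v ⟨x, h⟩ / s x else 0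
  have hφI : ∀ x : I, φ x = v x / s x := fun x => dif_pos x.2
  refine ⟨hA.eigenvalues i₀, φ, ?_, fun x hx => dif_neg hx, fun x hx => ?_⟩
  · intro h
    apply hv0
    ext j
    have h1 := hφI j
    rw [h, Pi.zero_apply, eq_comm, div_eq_zero_iff] at h1
    exact h1.resolve_right (hs j).ne'
  · have h1 : μ x * graphLap ω μ φ x = ∑ y ∈ Ω, ω x y * (φ y - φ x) :=
      measure_mul_graphLap hG x Ω hx.2 φ
    have h2 : ∑ y ∈ Ω, ω x y * φ y = ∑ y : I, ω x y * (v y / s y) := by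
      have h3 : ∑ y ∈ Ω, ω x y * φ y = ∑ y ∈ hfin.toFinset, ω x y * φ y := by
        symm
        refine Finset.sum_subset (fun y hy => (hfin.mem_toFinset.1 hy).1) fun y _ hy => ?_
        have : φ y = 0 := dif_neg fun h => hy (hfin.mem_toFinset.2 h)
        rw [this, mul_zero]
      rw [h3, Finset.sum_subtype (p := fun y => y ∈ finInterior ω Ω) _
        (fun y => hfin.mem_toFinset) (fun y => ω x y * φ y)]
      exact Finset.sum_congr rfl fun y _ => by rw [hφI]
    have h4 := congrFun hv ⟨x, hx⟩
    simp only [A, Matrix.sub_mulVec, Pi.sub_apply, Matrix.mulVec_diagonal, Pi.smul_apply,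
      smul_eq_mul] at h4
    simp only [Matrix.mulVec, dotProduct, Matrix.of_apply] at h4
    have h5 : ∑ y : I, ω x y / (s x * s y) * v y = (∑ y : I, ω x y * (v y / s y)) / s x := by
      rw [Finset.sum_div]
      refine Finset.sum_congr rfl fun y _ => ?_
      have := (hs x).ne'
      have := (hs y).ne'
      field_simp
    rw [h5, ← h2] at h4
    have h6 : φ x = v ⟨x, hx⟩ / s x := hφI ⟨x, hx⟩
    have h7 : v ⟨x, hx⟩ = φ x * s x := by rw [h6, div_mul_cancel₀ _ (hs x).ne']
    rw [h7] at h4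
    simp only [mul_sub, Finset.sum_sub_distrib, ← Finset.sum_mul] at h1
    have hμ := hG.measurePos x
    have hsx := (hs x).ne'
    apply mul_left_cancel₀ hμ.ne'
    rw [mul_neg, h1]
    generalize hA.eigenvalues i₀ = l at h4 ⊢
    rw [← hss x] at h4 ⊢
    field_simp at h4
    linear_combination h4

/-- A nonzero nonnegative function on `Ω`, vanishing off its interior, that satisfies
`Δw ≥ -εw`. -/
theorem exists_nonneg_subeigenfunction (hG : IsWeightedGraph ω μ) (Ω : Finset V)
    (hΩ : (finInterior ω Ω).Nonempty) {ε : ℝ} (hε : lambdaOne ω μ Ω < ε) :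
    ∃ w : V → ℝ, (∀ x, 0 ≤ w x) ∧ (∃ x ∈ Ω, 0 < w x) ∧
      (∀ x, x ∉ finInterior ω Ω → w x = 0) ∧
      ∀ x ∈ Ω, -(ε * (μ x * w x)) ≤ ∑ y ∈ Ω, ω x y * (w y - w x) := by
  obtain ⟨l, ⟨φ, hφ0, hφ, hl⟩, hlε⟩ :=
    exists_lt_of_csInf_lt (exists_dirichlet_eigenvalue hG Ω hΩ) hε
  refine ⟨fun x => |φ x|, fun x => abs_nonneg _, ?_, fun x hx => by simp [hφ x hx], ?_⟩
  · obtain ⟨x, hx⟩ := Function.ne_iff.1 hφ0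
    refine ⟨x, ?_, abs_pos.2 hx⟩
    by_contra h
    exact hx (hφ x fun h' => h h'.1)
  · intro x _
    by_cases hx : x ∈ finInterior ω Ω
    · have h1 := measure_mul_graphLap hG x Ω hx.2 φ
      have h2 := hl x hx
      have h3 : ∑ y ∈ Ω, ω x y * (φ y - φ x) = -(l * (μ x * φ x)) := by
        rw [← h1]; linear_combination -μ x * h2
      have hμ := hG.measurePos x
      have h4 : -(l * (μ x * |φ x|)) ≤ ∑ y ∈ Ω, ω x y * (|φ y| - |φ x|) := by
        rcases le_total 0 (φ x) with h | h
        · rw [abs_of_nonneg h, ← h3]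
          exact Finset.sum_le_sum fun y _ => mul_le_mul_of_nonneg_left
            (sub_le_sub_right (le_abs_self _) _) (hG.nonneg x y)
        · rw [abs_of_nonpos h]
          calc -(l * (μ x * -φ x)) = -∑ y ∈ Ω, ω x y * (φ y - φ x) := by rw [h3]; ring
            _ = ∑ y ∈ Ω, ω x y * (-φ y - -φ x) := by
              rw [← Finset.sum_neg_distrib]
              exact Finset.sum_congr rfl fun y _ => by ring
            _ ≤ _ := Finset.sum_le_sum fun y _ => mul_le_mul_of_nonneg_left
              (sub_le_sub_right (neg_le_abs _) _) (hG.nonneg x y)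
      refine le_trans ?_ h4
      have : 0 ≤ μ x * |φ x| := by positivity
      nlinarith
    · simp only [hφ x hx, abs_zero, mul_zero, neg_zero, sub_zero]
      exact Finset.sum_nonneg fun y _ => mul_nonneg (hG.nonneg x y) (abs_nonneg _)

end Laplacian

/-- A positive function with `J' ≥ J^p - εJ` on `[0, T)` forces `T` to be small. -/
theorem blowup_time_le {p ε T : ℝ} (hp : 1 < p) (hε : 0 < ε) {J J' : ℝ → ℝ}
    (hJc : ContinuousOn J (Ico 0 T)) (hJd : ∀ t ∈ Ioo 0 T, HasDerivAt J (J' t) t)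
    (hJ : ∀ t ∈ Ico 0 T, 0 ≤ J t) (hJ0 : 0 < J 0)
    (hJ' : ∀ t ∈ Ioo 0 T, J t ^ p - ε * J t ≤ J' t) {t : ℝ} (ht : t ∈ Ico 0 T) :
    (1 - ε * J 0 ^ (1 - p)) * ((p - 1) * t) ≤ J 0 ^ (1 - p) := by
  have hT : (0:ℝ) ∈ Ico 0 T := ⟨le_rfl, ht.1.trans_lt ht.2⟩
  have hpos : ∀ t ∈ Ico 0 T, 0 < J t := by
    have hm : MonotoneOn (fun t => J t * Real.exp (ε * t)) (Ico 0 T) := by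
      have hd : ∀ t ∈ Ioo 0 T, HasDerivAt (fun t => J t * Real.exp (ε * t))
          (J' t * Real.exp (ε * t) + J t * (Real.exp (ε * t) * ε)) t := fun t ht =>
        (hJd t ht).mul (((hasDerivAt_id t).const_mul ε).exp.congr_deriv (by simp))
      refine monotoneOn_of_deriv_nonneg (convex_Ico 0 T) (by fun_prop) ?_ ?_ <;>
        rw [interior_Ico]
      · exact fun t ht => (hd t ht).differentiableAt.differentiableWithinAt
      · intro t ht
        rw [(hd t ht).deriv]
        have h1 := hJ' t ht
        have h2 : 0 ≤ J t ^ p := Real.rpow_nonneg (hJ t (Ioo_subset_Ico_self ht)) p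
        have h3 := Real.exp_pos (ε * t)
        have : 0 ≤ (J' t + ε * J t) * Real.exp (ε * t) :=
          mul_nonneg (by linarith) h3.le
        linarith
    intro t ht
    have := hm hT ht ht.1
    simp only [mul_zero, Real.exp_zero, mul_one] at this
    exact pos_of_mul_pos_left (hJ0.trans_le this) (Real.exp_pos _).le
  have hm : MonotoneOn (fun t => (1 - ε * J t ^ (1 - p)) * Real.exp (-(ε * (p - 1) * t)))
      (Ico 0 T) := by
    have hd : ∀ t ∈ Ioo 0 T, HasDerivAt
        (fun t => (1 - ε * J t ^ (1 - p)) * Real.exp (-(ε * (p - 1) * t)))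
        (-(ε * (J' t * (1 - p) * J t ^ (1 - p - 1))) * Real.exp (-(ε * (p - 1) * t)) +
          (1 - ε * J t ^ (1 - p)) * (Real.exp (-(ε * (p - 1) * t)) * -(ε * (p - 1)))) t := by
      intro t ht
      have h1 := (hJd t ht).rpow_const (p := 1 - p)
        (Or.inl (hpos t (Ioo_subset_Ico_self ht)).ne')
      exact ((h1.const_mul ε).const_sub 1).mul
        (((hasDerivAt_id t).const_mul (ε * (p - 1))).neg.exp.congr_deriv (by simp))
    refine monotoneOn_of_deriv_nonneg (convex_Ico 0 T) ?_ ?_ ?_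
    · refine ContinuousOn.mul (continuousOn_const.sub (continuousOn_const.mul
        (hJc.rpow_const fun t ht => Or.inl (hpos t ht).ne'))) (by fun_prop)
    · rw [interior_Ico]
      exact fun t ht => (hd t ht).differentiableAt.differentiableWithinAt
    · rw [interior_Ico]
      intro t ht
      rw [(hd t ht).deriv]
      have hJt := hpos t (Ioo_subset_Ico_self ht)
      have h1 := mul_le_mul_of_nonneg_right (hJ' t ht)
        (Real.rpow_nonneg hJt.le (1 - p - 1))
      have h2 : J t ^ p * J t ^ (1 - p - 1) = 1 := by
        rw [← Real.rpow_add hJt]; simp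
      have h3 : J t * J t ^ (1 - p - 1) = J t ^ (1 - p) := by
        rw [mul_comm, ← Real.rpow_add_one hJt.ne']; congr 1; ring
      rw [sub_mul, mul_assoc, h2, h3] at h1
      have h4 : 0 ≤ ε * (p - 1) * Real.exp (-(ε * (p - 1) * t)) *
          (J' t * J t ^ (1 - p - 1) - (1 - ε * J t ^ (1 - p))) :=
        mul_nonneg (mul_nonneg (mul_nonneg hε.le (by linarith)) (Real.exp_pos _).le)
          (by linarith)
      linarith
  have h1 := hm hT ht ht.1
  simp only [mul_zero, neg_zero, Real.exp_zero, mul_one] at h1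
  set Y := J 0 ^ (1 - p) with hY
  have hYpos : 0 < Y := Real.rpow_pos_of_pos hJ0 _
  rcases le_total (1 - ε * Y) 0 with h | h
  · exact (mul_nonpos_of_nonpos_of_nonneg h (mul_nonneg (by linarith) ht.1)).trans hYpos.le
  · rw [Real.exp_neg, ← div_eq_mul_inv, le_div_iff₀ (Real.exp_pos _)] at h1
    have h2 : 0 < J t ^ (1 - p) := Real.rpow_pos_of_pos (hpos t ht) _
    have h3 := mul_le_mul_of_nonneg_left (Real.add_one_le_exp (ε * (p - 1) * t)) h
    have h4 : ε * ((1 - ε * Y) * ((p - 1) * t)) ≤ ε * Y := by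
      nlinarith [mul_pos hε h2]
    exact le_of_mul_le_mul_left h4 hε

/-- Averaging a solution against a nonnegative `w` with `Δw ≥ -εw` bounds its life span. -/
theorem IsHeatSol.time_le_of_subeigenfunction {V : Type*} {ω : V → V → ℝ} {μ : V → ℝ}
    (hG : IsWeightedGraph ω μ) {p : ℝ} (hp : 1 < p) {ψ0 : V → ℝ} {T : ℝ} {u : V → ℝ → ℝ}
    (hu : IsHeatSol (graphLap ω μ) p ψ0 T u) {ε a : ℝ} (hε : 0 < ε) (ha : 0 < a)
    (Ω : Finset V) (hψ : ∀ x ∈ Ω, a ≤ ψ0 x) {w : V → ℝ} (hw : ∀ x, 0 ≤ w x)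
    (hwne : ∃ x ∈ Ω, 0 < w x) (hw0 : ∀ x, x ∉ finInterior ω Ω → w x = 0)
    (hwΔ : ∀ x ∈ Ω, -(ε * (μ x * w x)) ≤ ∑ y ∈ Ω, ω x y * (w y - w x))
    {t : ℝ} (ht : t ∈ Ico 0 T) :
    (1 - ε * a ^ (1 - p)) * ((p - 1) * t) ≤ a ^ (1 - p) := by
  set Z := ∑ x ∈ Ω, μ x * w x with hZ
  have hZpos : 0 < Z := by
    obtain ⟨x, hx, hwx⟩ := hwne
    exact Finset.sum_pos' (fun y _ => mul_nonneg (hG.measurePos y).le (hw y))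
      ⟨x, hx, mul_pos (hG.measurePos x) hwx⟩
  let c : V → ℝ := fun x => μ x * w x / Z
  have hc : ∀ x, 0 ≤ c x := fun x =>
    div_nonneg (mul_nonneg (hG.measurePos x).le (hw x)) hZpos.le
  have hc1 : ∑ x ∈ Ω, c x = 1 := by
    rw [← Finset.sum_div, ← hZ, div_self hZpos.ne']
  let J : ℝ → ℝ := fun t => ∑ x ∈ Ω, c x * u x t
  let J' : ℝ → ℝ := fun t => ∑ x ∈ Ω, c x * (graphLap ω μ (fun y => u y t) x + u x t ^ p)
  have hJ0 : a ≤ J 0 := by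
    calc a = ∑ x ∈ Ω, c x * a := by rw [← Finset.sum_mul, hc1, one_mul]
      _ ≤ J 0 := Finset.sum_le_sum fun x hx => mul_le_mul_of_nonneg_left
        (by rw [hu.init]; exact hψ x hx) (hc x)
  have hJ' : ∀ t ∈ Ioo 0 T, J t ^ p - ε * J t ≤ J' t := by
    intro t ht
    have hut : ∀ x, 0 ≤ u x t := fun x => hu.nonneg x t (Ioo_subset_Ico_self ht)
    have h1 : J t ^ p ≤ ∑ x ∈ Ω, c x * u x t ^ p :=
      Real.rpow_arith_mean_le_arith_mean_rpow Ω c (fun x => u x t) (fun x _ => hc x) hc1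
        (fun x _ => hut x) hp.le
    have h2 : ∀ x ∈ Ω, c x * graphLap ω μ (fun y => u y t) x =
        (∑ y ∈ Ω, ω x y * w x * (u y t - u x t)) / Z := by
      intro x _
      by_cases hx : x ∈ finInterior ω Ω
      · have h := measure_mul_graphLap hG x Ω hx.2 (fun y => u y t)
        calc c x * graphLap ω μ (fun y => u y t) x
            = w x * (μ x * graphLap ω μ (fun y => u y t) x) / Z := by ring
          _ = _ := by
            rw [h, Finset.mul_sum]
            congr 1
            exact Finset.sum_congr rfl fun y _ => by ring
      · simp [c, hw0 x hx]
    have h3 : ∑ x ∈ Ω, ∑ y ∈ Ω, ω x y * w x * (u y t - u x t) =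
        ∑ x ∈ Ω, u x t * ∑ y ∈ Ω, ω x y * (w y - w x) := by
      have h4 : ∑ x ∈ Ω, ∑ y ∈ Ω, ω x y * w x * u y t =
          ∑ x ∈ Ω, ∑ y ∈ Ω, ω x y * w y * u x t := by
        rw [Finset.sum_comm]
        exact Finset.sum_congr rfl fun x _ => Finset.sum_congr rfl fun y _ => by
          rw [hG.symm y x]
      simp only [mul_sub, Finset.sum_sub_distrib, h4, Finset.mul_sum]
      congr 1 <;> exact Finset.sum_congr rfl fun x _ => Finset.sum_congr rfl fun y _ => by ring
    have h5 : -(ε * J t) ≤ ∑ x ∈ Ω, c x * graphLap ω μ (fun y => u y t) x := by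
      rw [Finset.sum_congr rfl h2, ← Finset.sum_div, h3, le_div_iff₀ hZpos]
      calc -(ε * J t) * Z = ∑ x ∈ Ω, u x t * -(ε * (μ x * w x)) := by
            simp only [J, c, Finset.mul_sum, ← Finset.sum_neg_distrib, Finset.sum_mul]
            exact Finset.sum_congr rfl fun x _ => by field_simp
        _ ≤ _ := Finset.sum_le_sum fun x hx => mul_le_mul_of_nonneg_left (hwΔ x hx) (hut x)
    simp only [J', mul_add, Finset.sum_add_distrib]
    linarith
  have h := blowup_time_le hp hε (J := J) (J' := J')
    (continuousOn_finsetSum _ fun x _ => continuousOn_const.mul (hu.cont x))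
    (fun t ht => HasDerivAt.fun_sum fun x _ => (hu.eqn x t ht).const_mul (c x))
    (fun t ht => Finset.sum_nonneg fun x _ => mul_nonneg (hc x) (hu.nonneg x t ht))
    (ha.trans_le hJ0) hJ' ht
  have hY : J 0 ^ (1 - p) ≤ a ^ (1 - p) :=
    Real.rpow_le_rpow_of_nonpos ha hJ0 (by linarith)
  have hpt : 0 ≤ (p - 1) * t := mul_nonneg (by linarith) ht.1
  refine le_trans (mul_le_mul_of_nonneg_right ?_ hpt) (h.trans hY)
  nlinarith

/-- Under the eigenvalue condition every solution with data `lam • ψ` lives at most for the time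
of the space-independent solution with data `lam * psiInf`. -/
theorem IsHeatSol.time_le_of_eigenCond {V : Type*} {ω : V → V → ℝ} {μ : V → ℝ}
    (hG : IsWeightedGraph ω μ) {p : ℝ} (hp : 1 < p) {ψ : V → ℝ} {xt : V} {psiInf : ℝ}
    (hpsiInf : 0 < psiInf)
    (hlim : ∀ ε > (0:ℝ), ∃ R : ℕ, ∀ x, R ≤ graphDist ω xt x → |ψ x - psiInf| < ε)
    (hEC : EigenCond ω μ xt) {lam : ℝ} (hlam : 0 < lam) {T : ℝ} {u : V → ℝ → ℝ} (hT : 0 < T)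
    (hu : IsHeatSol (graphLap ω μ) p (fun x => lam * ψ x) T u) :
    (p - 1) * T ≤ (lam * psiInf) ^ (1 - p) := by
  have key : ∀ t ∈ Ico 0 T, ∀ c ∈ Ioo 0 psiInf, ∀ ε > 0,
      (1 - ε * (lam * c) ^ (1 - p)) * ((p - 1) * t) ≤ (lam * c) ^ (1 - p) := by
    intro t ht c hc ε hε
    obtain ⟨R, hR⟩ := hlim (psiInf - c) (sub_pos.2 hc.2)
    obtain ⟨Ω, -, hΩ, hl, hd⟩ := hEC ε hε (R + 1) (by positivity)
    obtain ⟨w, hw, hwne, hw0, hwΔ⟩ := exists_nonneg_subeigenfunction hG Ω hΩ hl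
    refine hu.time_le_of_subeigenfunction hG hp hε (mul_pos hlam hc.1) Ω (fun x hx => ?_)
      hw hwne hw0 hwΔ ht
    have h1 : R ≤ graphDist ω xt x := by
      have := hd x hx
      exact_mod_cast (by linarith : (R:ℝ) ≤ graphDist ω xt x)
    have h2 := (abs_lt.1 (hR x h1)).1
    exact mul_le_mul_of_nonneg_left (by linarith) hlam.le
  have key2 : ∀ t ∈ Ico 0 T, ∀ c ∈ Ioo 0 psiInf, (p - 1) * t ≤ (lam * c) ^ (1 - p) := by
    intro t ht c hc
    have hlim : Tendsto (fun ε : ℝ => (1 - ε * (lam * c) ^ (1 - p)) * ((p - 1) * t)) (𝓝[>] 0)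
        (𝓝 ((1 - 0 * (lam * c) ^ (1 - p)) * ((p - 1) * t))) :=
      ((by fun_prop : Continuous fun ε : ℝ =>
        (1 - ε * (lam * c) ^ (1 - p)) * ((p - 1) * t)).tendsto 0).mono_left nhdsWithin_le_nhds
    rw [zero_mul, sub_zero, one_mul] at hlim
    exact le_of_tendsto hlim (eventually_mem_nhdsWithin.mono fun ε hε => key t ht c hc ε hε)
  have key3 : ∀ t ∈ Ico 0 T, (p - 1) * t ≤ (lam * psiInf) ^ (1 - p) := by
    intro t ht
    have hcont : ContinuousAt (fun c : ℝ => (lam * c) ^ (1 - p)) psiInf :=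
      ContinuousAt.rpow_const (by fun_prop) (Or.inl (mul_pos hlam hpsiInf).ne')
    refine ge_of_tendsto (hcont.tendsto.mono_left (nhdsWithin_le_nhds (s := Iio psiInf))) ?_
    filter_upwards [Ioo_mem_nhdsLT hpsiInf] with c hc using key2 t ht c hc
  have hcont : Tendsto (fun t : ℝ => (p - 1) * t) (𝓝[<] T) (𝓝 ((p - 1) * T)) :=
    ((by fun_prop : Continuous fun t : ℝ => (p - 1) * t).tendsto T).mono_left nhdsWithin_le_nhds
  refine le_of_tendsto hcont ?_
  filter_upwards [Ioo_mem_nhdsLT hT] with t ht using key3 t (Ioo_subset_Ico_self ht)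

/-- A global Picard–Lindelöf theorem for bounded Lipschitz vector fields on the bounded functions
on a set. -/
theorem exists_bounded_ode_solution {V : Type*} {T : ℝ} (hT : 0 < T)
    (F : ℝ → (V → ℝ) → V → ℝ) {L K : ℝ} (hL : 0 ≤ L) (hK : 0 ≤ K) {g : ℝ → ℝ}
    (hg : Continuous g) (hFL : ∀ t v x, |F t v x| ≤ L)
    (hFK : ∀ t v v' r, (∀ x, |v x - v' x| ≤ r) → ∀ x, |F t v x - F t v' x| ≤ K * r)
    (hFg : ∀ t s v x, |F t v x - F s v x| ≤ K * |g t - g s|)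
    (ψ0 : V → ℝ) {A : ℝ} (hψ0 : ∀ x, |ψ0 x| ≤ A) :
    ∃ u : V → ℝ → ℝ, (∀ x, u x 0 = ψ0 x) ∧ ∀ x, ∀ t ∈ Icc 0 T,
      HasDerivWithinAt (u x) (F t (fun y => u y t) x) (Icc 0 T) t := by
  let _ : TopologicalSpace V := ⊥
  have : DiscreteTopology V := ⟨rfl⟩
  let G : ℝ → BoundedContinuousFunction V ℝ → BoundedContinuousFunction V ℝ := fun t v =>
    BoundedContinuousFunction.ofNormedAddCommGroupDiscrete (F t v) L (hFL t v)
  let x₀ : BoundedContinuousFunction V ℝ :=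
    BoundedContinuousFunction.ofNormedAddCommGroupDiscrete ψ0 A hψ0
  have hP : IsPicardLindelof G (tmin := 0) (tmax := T) ⟨0, le_rfl, hT.le⟩ x₀
      (L.toNNReal * T.toNNReal) 0 L.toNNReal K.toNNReal := by
    refine ⟨fun t _ => LipschitzWith.lipschitzOnWith (LipschitzWith.of_dist_le_mul fun v v' => ?_),
      fun v _ => Continuous.continuousOn ?_, fun t _ v _ => ?_, ?_⟩
    · rw [Real.coe_toNNReal _ hK]
      refine (BoundedContinuousFunction.dist_le (mul_nonneg hK dist_nonneg)).2 fun x => ?_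
      exact hFK t v v' (dist v v') (fun y => (Real.dist_eq _ _).symm.trans_le
        (BoundedContinuousFunction.dist_coe_le_dist y)) x
    · rw [continuous_iff_continuousAt]
      intro s
      refine tendsto_iff_dist_tendsto_zero.2 (squeeze_zero (fun _ => dist_nonneg)
        (g := fun t => K * |g t - g s|) (fun t => ?_) ?_)
      · exact (BoundedContinuousFunction.dist_le (by positivity)).2 fun x => hFg t s v x
      · have : Continuous fun t => K * |g t - g s| := by fun_prop
        simpa using this.tendsto s
    · rw [Real.coe_toNNReal _ hL]
      exact (BoundedContinuousFunction.norm_le hL).2 fun x => hFL t v x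
    · simp [hT.le]
  obtain ⟨α, hα0, hα⟩ := hP.exists_eq_forall_mem_Icc_hasDerivWithinAt₀
  refine ⟨fun x t => α t x, fun x => ?_, fun x t ht => ?_⟩
  · have : α 0 = x₀ := hα0
    simp only [this]
    rfl
  · exact (BoundedContinuousFunction.evalCLM ℝ x).hasFDerivAt.comp_hasDerivWithinAt t (hα t ht)

/-- A function that starts nonpositive and is nonincreasing wherever it is positive stays
nonpositive. -/
theorem nonpos_of_deriv_nonpos_of_pos {T : ℝ} {f f' : ℝ → ℝ} (hf0 : f 0 ≤ 0)
    (hf : ∀ t ∈ Icc 0 T, HasDerivWithinAt f (f' t) (Icc 0 T) t)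
    (hf' : ∀ t ∈ Icc 0 T, 0 < f t → f' t ≤ 0) {t : ℝ} (ht : t ∈ Icc 0 T) : f t ≤ 0 := by
  have key : ∀ δ > 0, f t ≤ δ * (1 + t) := by
    intro δ hδ
    refine image_le_of_deriv_right_lt_deriv_boundary (f := f) (f' := f') (a := 0) (b := T)
      (B := fun s => δ * (1 + s)) (B' := fun _ => δ)
      (fun s hs => (hf s hs).continuousWithinAt)
      (fun s hs => (hf s (Ico_subset_Icc_self hs)).mono_of_mem_nhdsWithin
        (Icc_mem_nhdsGE_of_mem hs)) ?_ (fun s => ?_) (fun s hs h => ?_) ht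
    · simp only [add_zero, mul_one]; linarith
    · simpa using ((hasDerivAt_id s).const_add 1).const_mul δ
    · refine (hf' s (Ico_subset_Icc_self hs) ?_).trans_lt hδ
      rw [h]
      have := hs.1
      positivity
  have hlim : Tendsto (fun δ : ℝ => δ * (1 + t)) (𝓝[>] 0) (𝓝 (0 * (1 + t))) :=
    ((by fun_prop : Continuous fun δ : ℝ => δ * (1 + t)).tendsto 0).mono_left nhdsWithin_le_nhds
  rw [zero_mul] at hlim
  exact ge_of_tendsto hlim (eventually_mem_nhdsWithin.mono fun δ hδ => key δ hδ)

/-- The solution of `g' = g^p`, `g 0 = A`, before its blow-up time. -/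
theorem exists_powerODE_solution {p A T : ℝ} (hp : 1 < p) (hA : 0 < A)
    (hTA : (p - 1) * T < A ^ (1 - p)) :
    ∃ g : ℝ → ℝ, g 0 = A ∧ ∀ t ∈ Icc 0 T, 0 ≤ g t ∧ HasDerivAt g (g t ^ p) t := by
  have hp' : p - 1 ≠ 0 := by linarith
  refine ⟨fun t => (A ^ (1 - p) - (p - 1) * t) ^ (-(1 / (p - 1))), ?_, fun t ht => ?_⟩
  · simp only [mul_zero, sub_zero]
    rw [← Real.rpow_mul hA.le]
    have : (1 - p) * -(1 / (p - 1)) = 1 := by field_simp; ring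
    rw [this, Real.rpow_one]
  · have hb : 0 < A ^ (1 - p) - (p - 1) * t := by nlinarith [ht.2]
    refine ⟨Real.rpow_nonneg hb.le _, ?_⟩
    have h1 := ((((hasDerivAt_id t).const_mul (p - 1)).const_sub (A ^ (1 - p))).rpow_const
      (p := -(1 / (p - 1))) (Or.inl hb.ne'))
    refine h1.congr_deriv ?_
    rw [← Real.rpow_mul hb.le]
    have h2 : -(1 / (p - 1)) - 1 = -(1 / (p - 1)) * p := by field_simp; ring
    simp only [id, h2]
    field_simp

theorem abs_rpow_sub_rpow_le {p K a b : ℝ} (hp : 1 < p) (ha : a ∈ Icc 0 K) (hb : b ∈ Icc 0 K) :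
    |a ^ p - b ^ p| ≤ p * K ^ (p - 1) * |a - b| := by
  refine (convex_Icc 0 K).norm_image_sub_le_of_norm_hasDerivWithin_le (f := fun x : ℝ => x ^ p)
    (fun x _ => (Real.hasDerivAt_rpow_const (Or.inr hp.le)).hasDerivWithinAt)
    (fun x hx => ?_) hb ha
  rw [Real.norm_of_nonneg (mul_nonneg (by linarith) (Real.rpow_nonneg hx.1 _))]
  exact mul_le_mul_of_nonneg_left (Real.rpow_le_rpow hx.1 hx.2 (by linarith)) (by linarith)

theorem abs_clamp_sub_clamp_le (a b c d : ℝ) :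
    |max 0 (min a b) - max 0 (min c d)| ≤ max |a - c| |b - d| := by
  refine (abs_max_sub_max_le_max _ _ _ _).trans ?_
  rw [sub_zero, abs_zero, max_eq_right (abs_nonneg _)]
  exact abs_min_sub_min_le_max _ _ _ _

theorem abs_graphLap_sub_graphLap_le {V : Type*} {ω : V → V → ℝ} {μ : V → ℝ}
    (hG : IsWeightedGraph ω μ) {C : ℝ} (hC : ∀ x, (∑' y, ω x y) ≤ C * μ x) {v v' : V → ℝ}
    {r : ℝ} (h : ∀ x, |v x - v' x| ≤ r) (x : V) :
    |graphLap ω μ v x - graphLap ω μ v' x| ≤ 2 * C * r := by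
  set S := (hG.locallyFinite x).toFinset with hS
  have hSω : ∀ y, 0 < ω x y → y ∈ S := fun y hy => by simpa [hS] using hy
  have hμ := hG.measurePos x
  have hr : 0 ≤ r := (abs_nonneg _).trans (h x)
  have h1 : ∑ y ∈ S, ω x y ≤ C * μ x := by
    have := tsum_weight_mul_eq_sum hG x S hSω (fun _ => 1)
    simp only [mul_one] at this
    exact this ▸ hC x
  have h2 : μ x * |graphLap ω μ v x - graphLap ω μ v' x| ≤ μ x * (2 * C * r) := by
    rw [← abs_of_pos hμ, ← abs_mul, abs_of_pos hμ, mul_sub, measure_mul_graphLap hG x S hSω,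
      measure_mul_graphLap hG x S hSω, ← Finset.sum_sub_distrib]
    calc |∑ y ∈ S, (ω x y * (v y - v x) - ω x y * (v' y - v' x))|
        ≤ ∑ y ∈ S, |ω x y * (v y - v x) - ω x y * (v' y - v' x)| :=
          Finset.abs_sum_le_sum_abs _ _
      _ ≤ ∑ y ∈ S, ω x y * (2 * r) := by
          refine Finset.sum_le_sum fun y _ => ?_
          rw [← mul_sub, abs_mul, abs_of_nonneg (hG.nonneg x y)]
          refine mul_le_mul_of_nonneg_left ?_ (hG.nonneg x y)
          have h3 := abs_le.1 (h x)
          have h4 := abs_le.1 (h y)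
          exact abs_le.2 ⟨by linarith, by linarith⟩
      _ = (∑ y ∈ S, ω x y) * (2 * r) := by rw [Finset.sum_mul]
      _ ≤ C * μ x * (2 * r) := mul_le_mul_of_nonneg_right h1 (by positivity)
      _ = μ x * (2 * C * r) := by ring
  exact le_of_mul_le_mul_left h2 hμ

theorem graphLap_nonneg_of_isMin {V : Type*} {ω : V → V → ℝ} {μ : V → ℝ}
    (hG : IsWeightedGraph ω μ) {v : V → ℝ} {x : V} (h : ∀ y, v x ≤ v y) :
    0 ≤ graphLap ω μ v x :=
  mul_nonneg (one_div_nonneg.2 (hG.measurePos x).le)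
    (tsum_nonneg fun y => mul_nonneg (hG.nonneg x y) (sub_nonneg.2 (h y)))

theorem graphLap_nonpos_of_isMax {V : Type*} {ω : V → V → ℝ} {μ : V → ℝ}
    (hG : IsWeightedGraph ω μ) {v : V → ℝ} {x : V} (h : ∀ y, v y ≤ v x) :
    graphLap ω μ v x ≤ 0 :=
  mul_nonpos_of_nonneg_of_nonpos (one_div_nonneg.2 (hG.measurePos x).le)
    (tsum_nonpos fun y => mul_nonpos_of_nonneg_of_nonpos (hG.nonneg x y) (sub_nonpos.2 (h y)))

/-- Solutions exist at least as long as the space-independent solution above them. -/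
theorem exists_isHeatSol {V : Type*} {ω : V → V → ℝ} {μ : V → ℝ}
    (hG : IsWeightedGraph ω μ) (hD : DmuFinite ω μ) {p : ℝ} (hp : 1 < p) {ψ0 : V → ℝ} {A T : ℝ}
    (hA : 0 < A) (hψ0 : ∀ x, 0 ≤ ψ0 x) (hψA : ∀ x, ψ0 x ≤ A) (hT : 0 < T)
    (hTA : (p - 1) * T < A ^ (1 - p)) :
    ∃ u, IsHeatSol (graphLap ω μ) p ψ0 T u := by
  obtain ⟨C₀, hC₀⟩ := hD
  obtain ⟨C, hC0, hC⟩ : ∃ C : ℝ, 0 ≤ C ∧ ∀ x, (∑' y, ω x y) ≤ C * μ x :=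
    ⟨max C₀ 0, le_max_right _ _, fun x => (hC₀ x).trans
      (mul_le_mul_of_nonneg_right (le_max_left _ _) (hG.measurePos x).le)⟩
  obtain ⟨g, hgA, hg⟩ := exists_powerODE_solution hp hA hTA
  have hgc : ContinuousOn g (Icc 0 T) := fun t ht => (hg t ht).2.continuousAt.continuousWithinAt
  obtain ⟨K, hK⟩ := isCompact_Icc.bddAbove_image hgc
  replace hK : ∀ t ∈ Icc 0 T, g t ≤ K := fun t ht => hK (mem_image_of_mem g ht)
  have hK0 : 0 ≤ K := (hg 0 ⟨le_rfl, hT.le⟩).1.trans (hK 0 ⟨le_rfl, hT.le⟩)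
  let b : ℝ → ℝ := fun t => g (max 0 (min t T))
  have hmem : ∀ t, max 0 (min t T) ∈ Icc 0 T := fun t =>
    ⟨le_max_left _ _, max_le hT.le (min_le_right _ _)⟩
  have hbg : ∀ t ∈ Icc 0 T, b t = g t := fun t ht => by
    simp only [b]; rw [min_eq_left ht.2, max_eq_right ht.1]
  have hbc : Continuous b := hgc.comp_continuous (by fun_prop) hmem
  have hb0 : ∀ t, 0 ≤ b t := fun t => (hg _ (hmem t)).1
  have hbK : ∀ t, b t ≤ K := fun t => hK _ (hmem t)
  let cl : ℝ → (V → ℝ) → V → ℝ := fun t v x => max 0 (min (v x) (b t))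
  have hcl : ∀ t v x, cl t v x ∈ Icc 0 (b t) := fun t v x =>
    ⟨le_max_left _ _, max_le (hb0 t) (min_le_right _ _)⟩
  have hclK : ∀ t v x, cl t v x ∈ Icc 0 K := fun t v x =>
    ⟨(hcl t v x).1, (hcl t v x).2.trans (hbK t)⟩
  let N : (V → ℝ) → V → ℝ := fun v x => graphLap ω μ v x + v x ^ p
  set M := 2 * C + p * K ^ (p - 1) with hM
  have hM0 : 0 ≤ M := by positivity
  have hN : ∀ v v' : V → ℝ, (∀ x, v x ∈ Icc 0 K) → (∀ x, v' x ∈ Icc 0 K) → ∀ r,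
      (∀ x, |v x - v' x| ≤ r) → ∀ x, |N v x - N v' x| ≤ M * r := by
    intro v v' hv hv' r h x
    have h1 := abs_graphLap_sub_graphLap_le hG hC h x
    have h2 := (abs_rpow_sub_rpow_le hp (hv x) (hv' x)).trans
      (mul_le_mul_of_nonneg_left (h x) (by positivity))
    calc |N v x - N v' x| = |(graphLap ω μ v x - graphLap ω μ v' x) + (v x ^ p - v' x ^ p)| := by
          simp only [N]; congr 1; ring
      _ ≤ _ := abs_add_le _ _
      _ ≤ M * r := by rw [hM, add_mul]; exact add_le_add h1 h2
  have hN0 : ∀ x, N (fun _ => 0) x = 0 := fun x => by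
    simp [N, graphLap, Real.zero_rpow (by linarith : p ≠ 0)]
  obtain ⟨u, hu0, hu⟩ := exists_bounded_ode_solution hT (fun t v => N (cl t v))
    (mul_nonneg hM0 hK0) hM0 hbc
    (fun t v x => by
      have := hN (cl t v) (fun _ => 0) (hclK t v) (fun _ => ⟨le_rfl, hK0⟩) K
        (fun y => by rw [sub_zero, abs_of_nonneg (hclK t v y).1]; exact (hclK t v y).2) x
      rwa [hN0, sub_zero] at this)
    (fun t v v' r h => hN _ _ (hclK t v) (hclK t v') r fun y =>
      (abs_clamp_sub_clamp_le _ _ _ _).trans (by simpa using h y))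
    (fun t s v => hN _ _ (hclK t v) (hclK s v) _ fun y =>
      (abs_clamp_sub_clamp_le _ _ _ _).trans (by simp))
    ψ0 (A := A) (fun x => by rw [abs_of_nonneg (hψ0 x)]; exact hψA x)
  have hu_nonneg : ∀ x, ∀ t ∈ Icc 0 T, 0 ≤ u x t := by
    intro x t ht
    have := nonpos_of_deriv_nonpos_of_pos (f := fun t => -u x t) (by simp [hu0, hψ0])
      (fun t ht => (hu x t ht).neg) (fun t ht h => ?_) ht
    · linarith
    · have h0 : cl t (fun y => u y t) x = 0 :=
        max_eq_left ((min_le_left _ _).trans (by linarith))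
      have := graphLap_nonneg_of_isMin hG (v := cl t fun y => u y t) (x := x)
        (fun y => by rw [h0]; exact (hcl t (fun y => u y t) y).1)
      simp only [N, h0]
      have := Real.rpow_nonneg (le_refl (0:ℝ)) p
      linarith
  have hu_le : ∀ x, ∀ t ∈ Icc 0 T, u x t ≤ g t := by
    intro x t ht
    have := nonpos_of_deriv_nonpos_of_pos (f := fun t => u x t - g t)
      (by simp [hu0, hgA, hψA])
      (fun t ht => (hu x t ht).sub (hg t ht).2.hasDerivWithinAt) (fun t ht h => ?_) ht
    · linarith
    · have h0 : cl t (fun y => u y t) x = b t := by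
        simp only [cl]
        rw [min_eq_right (by rw [hbg t ht]; linarith), max_eq_right (hb0 t)]
      have := graphLap_nonpos_of_isMax hG (v := cl t fun y => u y t) (x := x)
        (fun y => by rw [h0]; exact (hcl t (fun y => u y t) y).2)
      simp only [N, h0]
      rw [hbg t ht]
      linarith
  have hcl_eq : ∀ t ∈ Icc 0 T, cl t (fun y => u y t) = fun y => u y t := by
    intro t ht
    ext y
    simp only [cl]
    rw [hbg t ht, min_eq_left (hu_le y t ht), max_eq_right (hu_nonneg y t ht)]
  refine ⟨u, fun x t ht => hu_nonneg x t (Ico_subset_Icc_self ht),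
    fun x t ht => ((hu x t (Ico_subset_Icc_self ht)).continuousWithinAt).mono Ico_subset_Icc_self,
    fun T' hT' => ⟨K, fun x t ht => ?_⟩, fun x t ht => ?_, hu0⟩
  · have ht' : t ∈ Icc 0 T := ⟨ht.1, ht.2.trans hT'.2.le⟩
    rw [abs_of_nonneg (hu_nonneg x t ht')]
    exact (hu_le x t ht').trans (hK t ht')
  · have h := hu x t (Ioo_subset_Icc_self ht)
    rw [hcl_eq t (Ioo_subset_Icc_self ht)] at h
    exact h.hasDerivAt (Icc_mem_nhds ht.1 ht.2)

/-- The blow-up time of `g' = g^p` from `lam * a`, rescaled by `lam^(p-1)`, is independent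
of `lam`. -/
theorem rpow_mul_blowup_time {p a lam : ℝ} (ha : 0 < a) (hlam : 0 < lam) :
    lam ^ (p - 1) * ((lam * a) ^ (1 - p) / (p - 1)) = 1 / ((p - 1) * a ^ (p - 1)) := by
  have h1 : lam ^ (p - 1) * lam ^ (1 - p) = 1 := by
    rw [← Real.rpow_add hlam]; simp
  have h2 : a ^ (1 - p) = (a ^ (p - 1))⁻¹ := by
    rw [← Real.rpow_neg ha.le]; congr 1; ring
  rw [Real.mul_rpow hlam.le ha.le, mul_div_assoc, ← mul_assoc, h1, one_mul, h2, one_div, mul_inv,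
    div_eq_mul_inv, mul_comm]

/-- Theorem 1.5(3): under `D_μ < ∞`, (EC) and `ψ(x) → ψ_∞ > 0` as
`d(x̃,x) → ∞`, one has
`1/((p-1)‖ψ‖_∞^{p-1}) ≤ liminf_{λ→0} λ^{p-1} T_λ ≤ limsup_{λ→0} λ^{p-1} T_λ
 ≤ 1/((p-1) ψ_∞^{p-1})`. -/
theorem stmt4 {V : Type*} [Infinite V] [Countable V]
    (ω : V → V → ℝ) (μ : V → ℝ) (hG : IsWeightedGraph ω μ) (hD : DmuFinite ω μ)
    (p : ℝ) (hp : 1 < p)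
    (ψ : V → ℝ) (hψ0 : ∀ x, 0 ≤ ψ x) (hψbd : ∃ C : ℝ, ∀ x, ψ x ≤ C)
    (hψne : ∃ x, ψ x ≠ 0)
    (xt : V) (psiInf : ℝ) (hpsiInf : 0 < psiInf)
    (hlim : ∀ ε > (0:ℝ), ∃ R : ℕ, ∀ x, R ≤ graphDist ω xt x → |ψ x - psiInf| < ε)
    (hEC : EigenCond ω μ xt) :
    ENNReal.ofReal (1 / ((p - 1) * (⨆ x, ψ x) ^ (p - 1))) ≤
        liminf (fun lam : ℝ => ENNReal.ofReal (lam ^ (p - 1)) *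
          lifeSpan (graphLap ω μ) p (fun x => lam * ψ x)) (𝓝[>] (0:ℝ)) ∧
      liminf (fun lam : ℝ => ENNReal.ofReal (lam ^ (p - 1)) *
          lifeSpan (graphLap ω μ) p (fun x => lam * ψ x)) (𝓝[>] (0:ℝ)) ≤
        limsup (fun lam : ℝ => ENNReal.ofReal (lam ^ (p - 1)) *
          lifeSpan (graphLap ω μ) p (fun x => lam * ψ x)) (𝓝[>] (0:ℝ)) ∧
      limsup (fun lam : ℝ => ENNReal.ofReal (lam ^ (p - 1)) *
          lifeSpan (graphLap ω μ) p (fun x => lam * ψ x)) (𝓝[>] (0:ℝ)) ≤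
        ENNReal.ofReal (1 / ((p - 1) * psiInf ^ (p - 1))) := by
  have hp1 : 0 < p - 1 := sub_pos.2 hp
  refine ⟨?_, liminf_le_limsup, ?_⟩
  · obtain ⟨C, hC⟩ := hψbd
    have hle : ∀ x, ψ x ≤ ⨆ x, ψ x :=
      le_ciSup ⟨C, by rintro _ ⟨x, rfl⟩; exact hC x⟩
    obtain ⟨x₁, hx₁⟩ := hψne
    have hM : 0 < ⨆ x, ψ x := ((hψ0 x₁).lt_of_ne' hx₁).trans_le (hle x₁)
    refine le_liminf_of_le (h := ?_)
    filter_upwards [self_mem_nhdsWithin] with lam hlam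
    have hlam : 0 < lam := hlam
    rw [← rpow_mul_blowup_time hM hlam, ENNReal.ofReal_mul (Real.rpow_nonneg hlam.le _)]
    gcongr
    refine le_of_forall_lt fun c hc => ?_
    have hc' : c ≠ ⊤ := ne_top_of_lt hc
    obtain ⟨T, hcT, hT⟩ := exists_between
      ((ENNReal.lt_ofReal_iff_toReal_lt hc').1 hc)
    have hT0 : 0 < T := ENNReal.toReal_nonneg.trans_lt hcT
    have hex : ∃ u, IsHeatSol (graphLap ω μ) p (fun x => lam * ψ x) T u :=
      exists_isHeatSol hG hD hp (mul_pos hlam hM) (fun x => mul_nonneg hlam.le (hψ0 x))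
        (fun x => mul_le_mul_of_nonneg_left (hle x) hlam.le) hT0
        (by rwa [lt_div_iff₀ hp1, mul_comm] at hT)
    exact ((ENNReal.lt_ofReal_iff_toReal_lt hc').2 hcT).trans_le
      (le_iSup₂_of_le T ⟨hT0, hex⟩ le_rfl)
  · refine limsup_le_of_le (h := ?_)
    filter_upwards [self_mem_nhdsWithin] with lam hlam
    have hlam : 0 < lam := hlam
    rw [← rpow_mul_blowup_time hpsiInf hlam, ENNReal.ofReal_mul (Real.rpow_nonneg hlam.le _)]
    gcongr
    refine iSup₂_le fun T ⟨hT, u, hu⟩ => ENNReal.ofReal_le_ofReal ?_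
    rw [le_div_iff₀ hp1, mul_comm]
    exact hu.time_le_of_eigenCond hG hp hpsiInf hlim hEC hlam hT
end
end
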